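/- arXiv:1803.03980 — 8 statements merged into one kernel-verified Lean document; each statement's English description precedes it below -/
import Mathlib

section
/- Let D = {(τ,ρ) ∈ ℝ² : |τ| < 1, ρ > 0}, let Θ(τ,ρ) = ρ(1−τ²), and define F : D → ℝ² by F(τ,ρ) = ( τ/(ρ(1−τ²)), 1/(ρ(1−τ²)) ). Let η₂ be the bilinear form η₂((a,b),(c,d)) = ac − bd on ℝ², and at each (τ,ρ) ∈ D let ḡ_{(τ,ρ)} be the bilinear form ḡ((a,b),(c,d)) = ac + (τ/ρ)(ad + bc) − ((1−τ²)/ρ²) bd. Then F is differentiable on D and for all (τ,ρ) ∈ D and all v, w ∈ ℝ²: η₂(DF_{(τ,ρ)} v, DF_{(τ,ρ)} w) = Θ(τ,ρ)^{−2} · ḡ_{(τ,ρ)}(v, w). -/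
/-- The domain `D = {(τ,ρ) : |τ| < 1, ρ > 0}`. -/
def Dset : Set (ℝ × ℝ) := {p | |p.1| < 1 ∧ 0 < p.2}

/-- The conformal factor `Θ(τ,ρ) = ρ(1 − τ²)`. -/
def Theta (p : ℝ × ℝ) : ℝ := p.2 * (1 - p.1 ^ 2)

/-- The coordinate change `F(τ,ρ) = (τ/(ρ(1−τ²)), 1/(ρ(1−τ²)))` from F-gauge
coordinates to physical Minkowski coordinates. -/
noncomputable def Fmap (p : ℝ × ℝ) : ℝ × ℝ :=
  (p.1 / (p.2 * (1 - p.1 ^ 2)), 1 / (p.2 * (1 - p.1 ^ 2)))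

/-- The 2-dimensional Minkowski bilinear form `η₂((a,b),(c,d)) = ac − bd`. -/
def eta2 (v w : ℝ × ℝ) : ℝ := v.1 * w.1 - v.2 * w.2

/-- The bilinear form `ḡ_{(τ,ρ)}((a,b),(c,d)) = ac + (τ/ρ)(ad + bc) − ((1−τ²)/ρ²) bd`. -/
noncomputable def gbar (p v w : ℝ × ℝ) : ℝ :=
  v.1 * w.1 + (p.1 / p.2) * (v.1 * w.2 + v.2 * w.1)
    - ((1 - p.1 ^ 2) / p.2 ^ 2) * (v.2 * w.2)

theorem hasFDerivAt_Theta (p : ℝ × ℝ) :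
    HasFDerivAt Theta
      ((1 - p.1 ^ 2) • ContinuousLinearMap.snd ℝ ℝ ℝ
        - (2 * p.1 * p.2) • ContinuousLinearMap.fst ℝ ℝ ℝ) p := by
  have h₁ : HasFDerivAt (fun q : ℝ × ℝ => q.1) (ContinuousLinearMap.fst ℝ ℝ ℝ) p := hasFDerivAt_fst
  have h₂ : HasFDerivAt (fun q : ℝ × ℝ => q.2) (ContinuousLinearMap.snd ℝ ℝ ℝ) p := hasFDerivAt_snd
  refine (h₂.mul ((h₁.pow 2).const_sub 1)).congr_fderiv ?_
  ext <;> simp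
  ring

theorem hasFDerivAt_Fmap {p : ℝ × ℝ} (hp : Theta p ≠ 0) :
    HasFDerivAt Fmap
      (((Theta p ^ 2)⁻¹ • ((p.2 * (1 + p.1 ^ 2)) • ContinuousLinearMap.fst ℝ ℝ ℝ
          - (p.1 * (1 - p.1 ^ 2)) • ContinuousLinearMap.snd ℝ ℝ ℝ)).prod
        ((Theta p ^ 2)⁻¹ • ((2 * p.1 * p.2) • ContinuousLinearMap.fst ℝ ℝ ℝ
          - (1 - p.1 ^ 2) • ContinuousLinearMap.snd ℝ ℝ ℝ))) p := by
  have h₁ : HasFDerivAt (fun q : ℝ × ℝ => q.1) (ContinuousLinearMap.fst ℝ ℝ ℝ) p := hasFDerivAt_fst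
  have hinv : HasFDerivAt (fun q => (Theta q)⁻¹) _ p :=
    (hasDerivAt_inv hp).comp_hasFDerivAt p (hasFDerivAt_Theta p)
  have hF : Fmap = fun q => (q.1 * (Theta q)⁻¹, (Theta q)⁻¹) := by
    funext q
    simp [Fmap, Theta, div_eq_mul_inv]
  rw [hF]
  refine ((h₁.mul hinv).prodMk hinv).congr_fderiv ?_
  ext <;> simp <;> field_simp
  · rw [Theta]
    ring
  · ring

theorem Theta_pos {p : ℝ × ℝ} (hp : p ∈ Dset) : 0 < Theta p :=
  mul_pos hp.2 (sub_pos.2 ((sq_lt_one_iff_abs_lt_one _).2 hp.1))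

/-- `F` is differentiable on `D` and for all `(τ,ρ) ∈ D` and all `v, w`:
`η₂(DF v, DF w) = Θ⁻² · ḡ(v,w)`, i.e. the conformal relation `ḡ = Θ² η̃`. -/
theorem Fmap_conformal :
    ∀ p ∈ Dset, DifferentiableAt ℝ Fmap p ∧
      ∀ v w : ℝ × ℝ,
        eta2 (fderiv ℝ Fmap p v) (fderiv ℝ Fmap p w) = (Theta p ^ 2)⁻¹ * gbar p v w := by
  intro p hp
  have hΘ := (Theta_pos hp).ne'
  have hF := hasFDerivAt_Fmap hΘ
  refine ⟨hF.differentiableAt, fun v w => ?_⟩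
  have hρ : p.2 ≠ 0 := hp.2.ne'
  have hs : 1 - p.1 ^ 2 ≠ 0 := right_ne_zero_of_mul hΘ
  rw [hF.fderiv]
  simp only [eta2, gbar, Theta, ContinuousLinearMap.prod_apply, smul_apply, sub_apply,
    ContinuousLinearMap.coe_fst', ContinuousLinearMap.coe_snd', smul_eq_mul]
  field_simp
  ring
end

section
/- Fix an integer ℓ ≥ 2 and set λ₀ = √(ℓ(ℓ+1)), λ₁ = √((ℓ−1)(ℓ+2)). Let C₀,…,C₄ be C¹ functions of (τ,ρ) on an open set U ⊆ ℝ × ℝ containing part of the axis ρ = 0, satisfying the C-evolution system, and set α_n(τ) = C_n(τ,0) and β_n(τ,ρ) = (C_n(τ,ρ) − C_n(τ,0))/ρ for ρ ≠ 0. Then β₀,…,β₄ satisfy, at every point of U with ρ ≠ 0, the β-evolution system: −(1−τ)∂_τβ₀ − ρ∂_ρβ₀ + λ₁β₁ + (1−ℓ)β₀ = 0; −∂_τβ₁ − (λ₁/2)β₀ + (λ₀/2)β₂ + β₁ = 0; −∂_τβ₂ − (λ₀/2)β₁ + (λ₀/2)β₃ = 0; −∂_τβ₃ − (λ₀/2)β₂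 + (λ₁/2)β₄ − β₃ = 0; −(1+τ)∂_τβ₄ + ρ∂_ρβ₄ − λ₁β₃ − (1−ℓ)β₄ = 0. -/
/-- Partial derivative with respect to the first coordinate `τ`. -/
noncomputable def dtau (f : ℝ × ℝ → ℝ) (p : ℝ × ℝ) : ℝ := fderiv ℝ f p (1, 0)

/-- Partial derivative with respect to the second coordinate `ρ`. -/
noncomputable def drho (f : ℝ × ℝ → ℝ) (p : ℝ × ℝ) : ℝ := fderiv ℝ f p (0, 1)

/-- The partial derivatives of the difference quotient `(f (τ, ρ) - f (τ, 0)) / ρ` off the axis. -/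
theorem dtau_drho_axis_quotient {f g : ℝ × ℝ → ℝ} {p : ℝ × ℝ} (hp : p.2 ≠ 0)
    (hf : DifferentiableAt ℝ f p) (hf0 : DifferentiableAt ℝ f (p.1, 0))
    (hg : ∀ q : ℝ × ℝ, q.2 ≠ 0 → g q = (f q - f (q.1, 0)) / q.2) :
    dtau g p = (dtau f p - dtau f (p.1, 0)) / p.2 ∧ drho g p = (drho f p - g p) / p.2 := by
  have hev : g =ᶠ[nhds p] fun q => (f q - f (q.1, 0)) * q.2⁻¹ := by
    filter_upwards [continuous_snd.continuousAt.eventually_ne hp] with q hq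
    rw [hg q hq, div_eq_mul_inv]
  have hproj : HasFDerivAt (fun q : ℝ × ℝ => (q.1, (0 : ℝ)))
      ((ContinuousLinearMap.fst ℝ ℝ ℝ).prod 0) p :=
    hasFDerivAt_fst.prodMk (hasFDerivAt_const 0 p)
  have hα := HasFDerivAt.comp p hf0.hasFDerivAt hproj
  have hinv := (hasDerivAt_inv hp).comp_hasFDerivAt p (hasFDerivAt_snd (𝕜 := ℝ) (E := ℝ) (F := ℝ) (p := p))
  have hder := (((hf.hasFDerivAt.sub hα).mul hinv).congr_of_eventuallyEq hev).fderiv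
  rw [dtau, drho, hder, hg p hp]
  constructor
  · simp [dtau]
    field_simp
  · have hzero : fderiv ℝ f (p.1, 0) (0, 0) = 0 := map_zero _
    simp [drho, hzero]
    field_simp
    ring

/-- if `C₀,…,C₄` are C¹ solutions of the C-evolution system on an open
`U ⊆ ℝ × ℝ` containing part of the axis `ρ = 0`, and
`β_n(τ,ρ) = (C_n(τ,ρ) − C_n(τ,0))/ρ` for `ρ ≠ 0`, then `β₀,…,β₄` satisfy the
β-evolution system at every point of `U` with `ρ ≠ 0` (whose axial projection lies in `U`). -/
theorem beta_system_of_C_system (ℓ : ℕ) (hℓ : 2 ≤ ℓ) (lam0 lam1 : ℝ)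
    (hlam0 : lam0 = Real.sqrt ((ℓ : ℝ) * ((ℓ : ℝ) + 1)))
    (hlam1 : lam1 = Real.sqrt (((ℓ : ℝ) - 1) * ((ℓ : ℝ) + 2)))
    (U : Set (ℝ × ℝ)) (hU : IsOpen U)
    (C : Fin 5 → ℝ × ℝ → ℝ)
    (hreg : ∀ n, ∀ p ∈ U, DifferentiableAt ℝ (C n) p)
    (hev0 : ∀ p ∈ U, -(1 - p.1) * dtau (C 0) p - p.2 * drho (C 0) p
      + lam1 * C 1 p + (2 - (ℓ : ℝ)) * C 0 p = 0)
    (hev1 : ∀ p ∈ U, -dtau (C 1) p - lam1 / 2 * C 0 p + lam0 / 2 * C 2 p + C 1 p = 0)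
    (hev2 : ∀ p ∈ U, -dtau (C 2) p - lam0 / 2 * C 1 p + lam0 / 2 * C 3 p = 0)
    (hev3 : ∀ p ∈ U, -dtau (C 3) p - lam0 / 2 * C 2 p + lam1 / 2 * C 4 p - C 3 p = 0)
    (hev4 : ∀ p ∈ U, -(1 + p.1) * dtau (C 4) p + p.2 * drho (C 4) p
      - lam1 * C 3 p - (2 - (ℓ : ℝ)) * C 4 p = 0)
    (β : Fin 5 → ℝ × ℝ → ℝ)
    (hβ : ∀ n, ∀ p : ℝ × ℝ, p.2 ≠ 0 → β n p = (C n p - C n (p.1, 0)) / p.2) :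
    ∀ p ∈ U, p.2 ≠ 0 → ((p.1, 0) : ℝ × ℝ) ∈ U →
      (-(1 - p.1) * dtau (β 0) p - p.2 * drho (β 0) p
        + lam1 * β 1 p + (1 - (ℓ : ℝ)) * β 0 p = 0) ∧
      (-dtau (β 1) p - lam1 / 2 * β 0 p + lam0 / 2 * β 2 p + β 1 p = 0) ∧
      (-dtau (β 2) p - lam0 / 2 * β 1 p + lam0 / 2 * β 3 p = 0) ∧
      (-dtau (β 3) p - lam0 / 2 * β 2 p + lam1 / 2 * β 4 p - β 3 p = 0) ∧
      (-(1 + p.1) * dtau (β 4) p + p.2 * drho (β 4) p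
        - lam1 * β 3 p - (1 - (ℓ : ℝ)) * β 4 p = 0) := by
  intro p hp hρ hp0
  have hd n := dtau_drho_axis_quotient hρ (hreg n p hp) (hreg n _ hp0) (hβ n)
  refine ⟨?_, ?_, ?_, ?_, ?_⟩
  · have h := hev0 p hp
    have h0 := hev0 _ hp0
    rw [(hd 0).1, (hd 0).2, hβ 0 p hρ, hβ 1 p hρ]
    field_simp
    linear_combination h - h0
  · have h := hev1 p hp
    have h0 := hev1 _ hp0
    rw [(hd 1).1, hβ 0 p hρ, hβ 1 p hρ, hβ 2 p hρ]
    field_simp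
    linear_combination 2 * h - 2 * h0
  · have h := hev2 p hp
    have h0 := hev2 _ hp0
    rw [(hd 2).1, hβ 1 p hρ, hβ 3 p hρ]
    field_simp
    linear_combination 2 * h - 2 * h0
  · have h := hev3 p hp
    have h0 := hev3 _ hp0
    rw [(hd 3).1, hβ 2 p hρ, hβ 3 p hρ, hβ 4 p hρ]
    field_simp
    linear_combination 2 * h - 2 * h0
  · have h := hev4 p hp
    have h0 := hev4 _ hp0
    rw [(hd 4).1, (hd 4).2, hβ 3 p hρ, hβ 4 p hρ]
    field_simp
    linear_combination h - h0
end

section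
/- Fix an integer ℓ ≥ 2 and set λ₀ = √(ℓ(ℓ+1)), λ₁ = √((ℓ−1)(ℓ+2)). Suppose real numbers b₀, b₁, b₂, b₃, b₄ and d₁, d₂, d₃ satisfy: λ₁b₁ + (1−ℓ)b₀ = 0; −d₁ − (λ₁/2)b₀ + (λ₀/2)b₂ + b₁ = 0; −d₂ − (λ₀/2)b₁ + (λ₀/2)b₃ = 0; −d₃ − (λ₀/2)b₂ + (λ₁/2)b₄ − b₃ = 0; d₁ − (ℓ+1)b₁ + (1/2)(λ₀b₂ + λ₁b₀) = 0; d₂ − (ℓ+1)b₂ + (λ₀/2)(b₃ + b₁) = 0; d₃ − (ℓ+1)b₃ + (1/2)(λ₁b₄ + λ₀b₂) = 0. Then b₀ = b₄, b₁ = b₃ = √((ℓ−1)/(ℓ+2)) · b₄, and b₂ = √( ℓ(ℓ−1) / ((ℓ+1)(ℓ+2)) ) · b₄. -/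
/-- the β-evolution equations and β-constraints evaluated at the critical
set `I⁺` (`τ = 1`, `ρ = 0`), with `b_n = β_n(1,0)` and `d_n = ∂_τβ_n(1,0)`, force the
algebraic relations `b₀ = b₄`, `b₁ = b₃ = √((ℓ−1)/(ℓ+2)) b₄`,
`b₂ = √(ℓ(ℓ−1)/((ℓ+1)(ℓ+2))) b₄`. -/
theorem relations_at_Iplus (ℓ : ℕ) (hℓ : 2 ≤ ℓ) (lam0 lam1 : ℝ)
    (hlam0 : lam0 = Real.sqrt ((ℓ : ℝ) * ((ℓ : ℝ) + 1)))
    (hlam1 : lam1 = Real.sqrt (((ℓ : ℝ) - 1) * ((ℓ : ℝ) + 2)))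
    (b0 b1 b2 b3 b4 d1 d2 d3 : ℝ)
    (hev0 : lam1 * b1 + (1 - (ℓ : ℝ)) * b0 = 0)
    (hev1 : -d1 - lam1 / 2 * b0 + lam0 / 2 * b2 + b1 = 0)
    (hev2 : -d2 - lam0 / 2 * b1 + lam0 / 2 * b3 = 0)
    (hev3 : -d3 - lam0 / 2 * b2 + lam1 / 2 * b4 - b3 = 0)
    (hcon1 : d1 - ((ℓ : ℝ) + 1) * b1 + 1 / 2 * (lam0 * b2 + lam1 * b0) = 0)
    (hcon2 : d2 - ((ℓ : ℝ) + 1) * b2 + lam0 / 2 * (b3 + b1) = 0)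
    (hcon3 : d3 - ((ℓ : ℝ) + 1) * b3 + 1 / 2 * (lam1 * b4 + lam0 * b2) = 0) :
    b0 = b4 ∧
    b1 = Real.sqrt (((ℓ : ℝ) - 1) / ((ℓ : ℝ) + 2)) * b4 ∧
    b3 = Real.sqrt (((ℓ : ℝ) - 1) / ((ℓ : ℝ) + 2)) * b4 ∧
    b2 = Real.sqrt ((ℓ : ℝ) * ((ℓ : ℝ) - 1) / (((ℓ : ℝ) + 1) * ((ℓ : ℝ) + 2))) * b4 := by
  have hL : (2 : ℝ) ≤ ℓ := by exact_mod_cast hℓ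
  have pos_sub : (0 : ℝ) < (ℓ : ℝ) - 1 := by linarith
  have lam0_nonneg : 0 ≤ lam0 := hlam0 ▸ Real.sqrt_nonneg _
  have lam1_nonneg : 0 ≤ lam1 := hlam1 ▸ Real.sqrt_nonneg _
  have lam0_sq : lam0 ^ 2 = (ℓ : ℝ) * ((ℓ : ℝ) + 1) := by
    rw [hlam0, Real.sq_sqrt (by positivity)]
  have lam1_sq : lam1 ^ 2 = ((ℓ : ℝ) - 1) * ((ℓ : ℝ) + 2) := by
    rw [hlam1, Real.sq_sqrt (by positivity)]
  have h12 : lam0 * b2 = ℓ * b1 := by linarith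
  have h23 : lam0 * b3 = ((ℓ : ℝ) + 1) * b2 := by linarith
  have h34 : lam1 * b4 = ((ℓ : ℝ) + 2) * b3 := by linarith
  have h13 : b1 = b3 := by
    apply mul_left_cancel₀ (show (ℓ : ℝ) * ((ℓ : ℝ) + 1) ≠ 0 by positivity)
    linear_combination (-((ℓ : ℝ) + 1)) * h12 - lam0 * h23 + b3 * lam0_sq
  have h04 : b0 = b4 := by
    apply mul_left_cancel₀ (show ((ℓ : ℝ) - 1) * ((ℓ : ℝ) + 2) ≠ 0 by positivity)
    linear_combination
      (-((ℓ : ℝ) + 2)) * hev0 - lam1 * h34 + b4 * lam1_sq + lam1 * ((ℓ : ℝ) + 2) * h13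
  have sqrt_b3 : Real.sqrt (((ℓ : ℝ) - 1) / ((ℓ : ℝ) + 2)) = lam1 / ((ℓ : ℝ) + 2) := by
    rw [← Real.sqrt_sq (show 0 ≤ lam1 / ((ℓ : ℝ) + 2) by positivity), div_pow, lam1_sq]
    congr 1
    field_simp
  have sqrt_b2 : Real.sqrt ((ℓ : ℝ) * ((ℓ : ℝ) - 1) / (((ℓ : ℝ) + 1) * ((ℓ : ℝ) + 2))) =
      lam0 * lam1 / (((ℓ : ℝ) + 1) * ((ℓ : ℝ) + 2)) := by
    rw [← Real.sqrt_sq (show 0 ≤ lam0 * lam1 / (((ℓ : ℝ) + 1) * ((ℓ : ℝ) + 2)) by positivity),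
      div_pow, mul_pow, lam0_sq, lam1_sq]
    congr 1
    field_simp
  have hb3 : b3 = lam1 / ((ℓ : ℝ) + 2) * b4 := by
    field_simp
    linarith
  refine ⟨h04, ?_, ?_, ?_⟩
  · rw [sqrt_b3, h13, hb3]
  · rw [sqrt_b3, hb3]
  · rw [sqrt_b2]
    field_simp
    linear_combination (-((ℓ : ℝ) + 2)) * h23 - lam0 * h34
end

section
/- Fix an integer ℓ ≥ 2 and set λ₀ = √(ℓ(ℓ+1)), λ₁ = √((ℓ−1)(ℓ+2)). Suppose (α₀,…,α₄) and (α̂₀,…,α̂₄) are two C¹ quintuples of functions (−1,1) → ℝ, each satisfying the α-evolution system on (−1,1) and the α-constraints at τ = 0, with α₀(0) = α̂₀(0) and α₄(0) = α̂₄(0). Then α_n = α̂_n on (−1,1) for all n = 0,…,4. -/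
/-- The α-evolution system on `(−1,1)` for the spin-2 coefficient functions. -/
noncomputable def AlphaEvol (ℓ : ℕ) (lam0 lam1 : ℝ) (α : Fin 5 → ℝ → ℝ) : Prop :=
  ∀ τ ∈ Set.Ioo (-1 : ℝ) 1,
    ((1 - τ) * deriv (α 0) τ = lam1 * α 1 τ + (2 - (ℓ : ℝ)) * α 0 τ) ∧
    (deriv (α 1) τ = α 1 τ - lam1 / 2 * α 0 τ + lam0 / 2 * α 2 τ) ∧
    (deriv (α 2) τ = -(lam0 / 2) * α 1 τ + lam0 / 2 * α 3 τ) ∧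
    (deriv (α 3) τ = -α 3 τ - lam0 / 2 * α 2 τ + lam1 / 2 * α 4 τ) ∧
    ((1 + τ) * deriv (α 4) τ = -lam1 * α 3 τ - (2 - (ℓ : ℝ)) * α 4 τ)

/-- The α-constraints at `τ = 0`. -/
def AlphaConstr0 (ℓ : ℕ) (lam0 lam1 : ℝ) (α : Fin 5 → ℝ → ℝ) : Prop :=
  (-(ℓ : ℝ) * α 1 0 + 1 / 2 * (lam1 * α 0 0 + lam0 * α 2 0) = 0) ∧
  (-(ℓ : ℝ) * α 2 0 + lam0 / 2 * (α 1 0 + α 3 0) = 0) ∧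
  (-(ℓ : ℝ) * α 3 0 + 1 / 2 * (lam1 * α 4 0 + lam0 * α 2 0) = 0)

open Set in
/-- Solutions of a linear ODE `f' = A t f` with coefficients continuous on an open interval
are determined on that interval by their value at one point. -/
theorem eqOn_Ioo_of_hasDerivAt_clm {E : Type*} [NormedAddCommGroup E] [NormedSpace ℝ E]
    {A : ℝ → E →L[ℝ] E} {a b t₀ : ℝ} (hA : ContinuousOn A (Ioo a b)) (ht₀ : t₀ ∈ Ioo a b)
    {f g : ℝ → E} (hf : ∀ t ∈ Ioo a b, HasDerivAt f (A t (f t)) t)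
    (hg : ∀ t ∈ Ioo a b, HasDerivAt g (A t (g t)) t) (heq : f t₀ = g t₀) :
    EqOn f g (Ioo a b) := by
  intro t ht
  obtain ⟨p, hap, hp⟩ := exists_between (lt_min ht.1 ht₀.1)
  obtain ⟨q, hq, hqb⟩ := exists_between (max_lt ht.2 ht₀.2)
  obtain ⟨hpt, hpt₀⟩ := lt_min_iff.1 hp
  obtain ⟨hqt, hqt₀⟩ := max_lt_iff.1 hq
  have hsub : Icc p q ⊆ Ioo a b := Icc_subset_Ioo hap hqb
  obtain ⟨C, hC⟩ := isCompact_Icc.exists_bound_of_continuousOn (hA.mono hsub)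
  refine ODE_solution_unique_of_mem_Ioo (K := C.toNNReal) (v := fun t x ↦ A t x)
    (s := fun _ ↦ univ) (fun s hs ↦ ?_) ⟨hpt₀, hqt₀⟩
    (fun s hs ↦ ⟨hf s (hsub (Ioo_subset_Icc_self hs)), mem_univ _⟩)
    (fun s hs ↦ ⟨hg s (hsub (Ioo_subset_Icc_self hs)), mem_univ _⟩) heq ⟨hpt, hqt⟩
  refine ((A s).lipschitz.weaken ?_).lipschitzOnWith
  exact NNReal.le_toNNReal_of_coe_le (hC s (Ioo_subset_Icc_self hs))

open Set Matrix in
/-- Matrix form of `eqOn_Ioo_of_hasDerivAt_clm`. -/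
theorem eqOn_Ioo_of_hasDerivAt_mulVec {ι : Type*} [Fintype ι] [DecidableEq ι]
    {M : ℝ → Matrix ι ι ℝ} {a b t₀ : ℝ} (hM : ContinuousOn M (Ioo a b)) (ht₀ : t₀ ∈ Ioo a b)
    {f g : ℝ → ι → ℝ} (hf : ∀ t ∈ Ioo a b, HasDerivAt f (M t *ᵥ f t) t)
    (hg : ∀ t ∈ Ioo a b, HasDerivAt g (M t *ᵥ g t) t) (heq : f t₀ = g t₀) :
    EqOn f g (Ioo a b) := by
  let L : Matrix ι ι ℝ →ₗ[ℝ] (ι → ℝ) →L[ℝ] (ι → ℝ) :=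
    (Matrix.toLin' ≪≫ₗ LinearMap.toContinuousLinearMap).toLinearMap
  have hL : Continuous L := L.continuous_of_finiteDimensional
  exact eqOn_Ioo_of_hasDerivAt_clm (A := fun t ↦ L (M t)) (hL.comp_continuousOn hM) ht₀ hf hg heq

/-- The coefficient matrix of the α-evolution system solved for the derivatives. -/
noncomputable def alphaMatrix (ℓ : ℕ) (lam0 lam1 τ : ℝ) : Matrix (Fin 5) (Fin 5) ℝ :=
  !![(2 - (ℓ : ℝ)) / (1 - τ), lam1 / (1 - τ), 0, 0, 0;
     -(lam1 / 2), 1, lam0 / 2, 0, 0;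
     0, -(lam0 / 2), 0, lam0 / 2, 0;
     0, 0, -(lam0 / 2), -1, lam1 / 2;
     0, 0, 0, -lam1 / (1 + τ), -(2 - (ℓ : ℝ)) / (1 + τ)]

theorem continuousOn_alphaMatrix (ℓ : ℕ) (lam0 lam1 : ℝ) :
    ContinuousOn (alphaMatrix ℓ lam0 lam1) (Set.Ioo (-1 : ℝ) 1) := by
  have h1 : ∀ τ ∈ Set.Ioo (-1 : ℝ) 1, 1 - τ ≠ 0 := fun τ hτ ↦ (sub_pos.2 hτ.2).ne'
  have h2 : ∀ τ ∈ Set.Ioo (-1 : ℝ) 1, 1 + τ ≠ 0 := fun τ hτ ↦ by linarith [hτ.1] |> ne_of_gt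
  refine continuousOn_pi.2 fun i ↦ continuousOn_pi.2 fun j ↦ ?_
  fin_cases i <;> fin_cases j <;> simp [alphaMatrix] <;> fun_prop (disch := assumption)

theorem AlphaEvol.hasDerivAt {ℓ : ℕ} {lam0 lam1 : ℝ} {α : Fin 5 → ℝ → ℝ}
    (hev : AlphaEvol ℓ lam0 lam1 α) (hreg : ∀ n, ContDiffOn ℝ 1 (α n) (Set.Ioo (-1 : ℝ) 1))
    {τ : ℝ} (hτ : τ ∈ Set.Ioo (-1 : ℝ) 1) :
    HasDerivAt (fun t n ↦ α n t)
      ((alphaMatrix ℓ lam0 lam1 τ).mulVec fun n ↦ α n τ) τ := by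
  refine hasDerivAt_pi.2 fun n ↦ ?_
  have hd : HasDerivAt (α n) (deriv (α n) τ) τ :=
    (((hreg n).differentiableOn one_ne_zero).differentiableAt (Ioo_mem_nhds hτ.1 hτ.2)).hasDerivAt
  refine hd.congr_deriv ?_
  obtain ⟨e0, e1, e2, e3, e4⟩ := hev τ hτ
  have h1 : 1 - τ ≠ 0 := (sub_pos.2 hτ.2).ne'
  have h2 : 1 + τ ≠ 0 := by linarith [hτ.1] |> ne_of_gt
  fin_cases n <;> simp [alphaMatrix, Matrix.mulVec, dotProduct, Fin.sum_univ_five]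
  · field_simp
    linarith
  · linarith
  · linarith
  · linarith
  · field_simp
    linarith

/-- The α-constraints determine the data at `τ = 0` from `α₀(0)` and `α₄(0)`. -/
theorem AlphaConstr0.eq_of_eq {ℓ : ℕ} (hℓ : 2 ≤ ℓ) {lam0 lam1 : ℝ}
    (hlam0 : lam0 ^ 2 = (ℓ : ℝ) * ((ℓ : ℝ) + 1)) {α α' : Fin 5 → ℝ → ℝ}
    (hcon : AlphaConstr0 ℓ lam0 lam1 α) (hcon' : AlphaConstr0 ℓ lam0 lam1 α')
    (h0 : α 0 0 = α' 0 0) (h4 : α 4 0 = α' 4 0) (n : Fin 5) : α n 0 = α' n 0 := by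
  obtain ⟨c1, c2, c3⟩ := hcon
  obtain ⟨c1', c2', c3'⟩ := hcon'
  have hl : (2 : ℝ) ≤ ℓ := by exact_mod_cast hℓ
  have hl0 : (ℓ : ℝ) ≠ 0 := by positivity
  rw [h0] at c1
  rw [h4] at c3
  have key : (ℓ : ℝ) * ((ℓ : ℝ) - 1) * (α 2 0 - α' 2 0) = 0 := by
    linear_combination (-2 * (ℓ : ℝ)) * (c2 - c2') - lam0 * (c1 - c1') - lam0 * (c3 - c3')
      + (α 2 0 - α' 2 0) * hlam0
  have h2 : α 2 0 = α' 2 0 := by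
    have : (ℓ : ℝ) * ((ℓ : ℝ) - 1) ≠ 0 := mul_ne_zero hl0 (by linarith)
    exact sub_eq_zero.1 ((mul_eq_zero.1 key).resolve_left this)
  rw [h2] at c1 c3
  have h1 : α 1 0 = α' 1 0 := mul_left_cancel₀ hl0 (by linarith)
  have h3 : α 3 0 = α' 3 0 := mul_left_cancel₀ hl0 (by linarith)
  fin_cases n <;> assumption

/-- two C¹ constrained solutions of the α-evolution system on `(−1,1)` with
the same free data `α₀(0)`, `α₄(0)` coincide on `(−1,1)`. -/
theorem alpha_uniqueness (ℓ : ℕ) (hℓ : 2 ≤ ℓ) (lam0 lam1 : ℝ)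
    (hlam0 : lam0 = Real.sqrt ((ℓ : ℝ) * ((ℓ : ℝ) + 1)))
    (hlam1 : lam1 = Real.sqrt (((ℓ : ℝ) - 1) * ((ℓ : ℝ) + 2)))
    (α α' : Fin 5 → ℝ → ℝ)
    (hreg : ∀ n, ContDiffOn ℝ 1 (α n) (Set.Ioo (-1 : ℝ) 1))
    (hreg' : ∀ n, ContDiffOn ℝ 1 (α' n) (Set.Ioo (-1 : ℝ) 1))
    (hev : AlphaEvol ℓ lam0 lam1 α) (hev' : AlphaEvol ℓ lam0 lam1 α')
    (hcon : AlphaConstr0 ℓ lam0 lam1 α) (hcon' : AlphaConstr0 ℓ lam0 lam1 α')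
    (h0 : α 0 0 = α' 0 0) (h4 : α 4 0 = α' 4 0) :
    ∀ n, Set.EqOn (α n) (α' n) (Set.Ioo (-1 : ℝ) 1) := by
  have hsq : lam0 ^ 2 = (ℓ : ℝ) * ((ℓ : ℝ) + 1) := by
    rw [hlam0, Real.sq_sqrt (by positivity)]
  have huniq := eqOn_Ioo_of_hasDerivAt_mulVec (continuousOn_alphaMatrix ℓ lam0 lam1)
    (t₀ := 0) (by norm_num) (fun _ hτ ↦ hev.hasDerivAt hreg hτ)
    (fun _ hτ ↦ hev'.hasDerivAt hreg' hτ)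
    (funext fun n ↦ hcon.eq_of_eq hℓ hsq hcon' h0 h4 n)
  exact fun n τ hτ ↦ congrFun (huniq hτ) n
end

section
/- Fix an integer ℓ ≥ 2 and set λ₀ = √(ℓ(ℓ+1)), λ₁ = √((ℓ−1)(ℓ+2)). Let α₀,…,α₄ : (−1,1) → ℝ be C¹ functions satisfying the α-evolution system on (−1,1) and the α-constraints at τ = 0. Then there exist polynomials p₀,…,p₄ and real constants c₀,…,c₄ and d₀,…,d₄ such that for all τ ∈ (−1,1) and each n = 0,…,4: α_n(τ) = p_n(τ) + (1+τ)^{ℓ+2−n} (1−τ)^{ℓ−2+n} ( c_n·ln(1−τ) + d_n·ln(1+τ) ). Moreover, all the constants c_n, d_n vanish if and only if α₀(0) = α₄(0). -/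
open Polynomial in
/-- The first-order equation `(1 - τ²) y' + 2 m τ y = 1` has a solution which is a polynomial plus
a nonzero multiple of `(1 - τ²) ^ m * (log (1 + τ) - log (1 - τ))`. -/
theorem exists_polynomial_logDefect (m : ℕ) :
    ∃ (Q : ℝ[X]) (b : ℝ), b ≠ 0 ∧ ∀ τ : ℝ,
      (1 - τ ^ 2) * Q.derivative.eval τ + 2 * m * τ * Q.eval τ + 2 * b * (1 - τ ^ 2) ^ m = 1 := by
  induction m with
  | zero => exact ⟨0, 1 / 2, by norm_num, fun τ => by simp⟩
  | succ m ih =>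
    obtain ⟨Q, b, hb, hQ⟩ := ih
    have hm : (2 * m + 2 : ℝ) ≠ 0 := by positivity
    have hm' : (2 * m + 1 : ℝ) ≠ 0 := by positivity
    refine ⟨C ((2 * m + 1) / (2 * m + 2) : ℝ) * ((1 - X ^ 2) * Q) + C (1 / (2 * m + 2) : ℝ) * X,
      (2 * m + 1) / (2 * m + 2) * b, mul_ne_zero (div_ne_zero hm' hm) hb, fun τ => ?_⟩
    simp only [derivative_add, derivative_mul, derivative_C, derivative_sub, derivative_one,
      derivative_X_pow, derivative_X, eval_add, eval_mul, eval_sub, eval_C, eval_one, eval_pow,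
      eval_X, eval_zero, Nat.cast_add, Nat.cast_one, pow_succ (1 - τ ^ 2) m, Nat.cast_ofNat]
    field_simp
    linear_combination (2 * m + 1) * (1 - τ ^ 2) * hQ τ

/-- `f` is on `(-1, 1)` a polynomial plus
`k (1 + τ) ^ a (1 - τ) ^ b (log (1 + τ) - log (1 - τ))`. -/
def HasLogForm (a b : ℕ) (k : ℝ) (f : ℝ → ℝ) : Prop :=
  ∃ P : Polynomial ℝ, ∀ τ ∈ Set.Ioo (-1 : ℝ) 1,
    f τ = P.eval τ
      + (1 + τ) ^ a * (1 - τ) ^ b * (k * (Real.log (1 + τ) - Real.log (1 - τ)))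

theorem hasDerivAt_log_one_add_sub_log_one_sub {τ : ℝ} (hτ : τ ∈ Set.Ioo (-1 : ℝ) 1) :
    HasDerivAt (fun t => Real.log (1 + t) - Real.log (1 - t)) (1 / (1 + τ) + 1 / (1 - τ)) τ := by
  have h1 : 1 + τ ≠ 0 := by linarith [hτ.1]
  have h2 : 1 - τ ≠ 0 := by linarith [hτ.2]
  refine HasDerivAt.congr_deriv ((((hasDerivAt_id τ).const_add 1).log h1).sub
    (((hasDerivAt_id τ).const_sub 1).log h2)) ?_
  simp only [id]
  ring

theorem hasDerivAt_one_add_pow_mul_one_sub_pow (a b : ℕ) (τ : ℝ) :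
    HasDerivAt (fun t : ℝ => (1 + t) ^ (a + 1) * (1 - t) ^ (b + 1))
      ((1 + τ) ^ a * (1 - τ) ^ b * ((a + 1) * (1 - τ) - (b + 1) * (1 + τ))) τ := by
  refine HasDerivAt.congr_deriv ((((hasDerivAt_id τ).const_add 1).pow (a + 1)).mul
    (((hasDerivAt_id τ).const_sub 1).pow (b + 1))) ?_
  simp only [id, Nat.add_sub_cancel, Nat.cast_add, Nat.cast_one, Pi.pow_apply]
  ring

open Polynomial in
/-- The derivative of a function in logarithmic form. -/
theorem HasLogForm.exists_deriv {a b : ℕ} {k : ℝ} {f : ℝ → ℝ}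
    (hf : HasLogForm (a + 1) (b + 1) k f) :
    ∃ P : ℝ[X], ∀ τ ∈ Set.Ioo (-1 : ℝ) 1,
      deriv f τ = P.eval τ + (1 + τ) ^ a * (1 - τ) ^ b * ((a + 1) * (1 - τ) - (b + 1) * (1 + τ))
        * (k * (Real.log (1 + τ) - Real.log (1 - τ))) := by
  obtain ⟨P, hP⟩ := hf
  refine ⟨derivative P + C (2 * k) * (1 + X) ^ a * (1 - X) ^ b, fun τ hτ => ?_⟩
  have h1 : 1 + τ ≠ 0 := by linarith [hτ.1]
  have h2 : 1 - τ ≠ 0 := by linarith [hτ.2]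
  have hd := (P.hasDerivAt τ).add ((hasDerivAt_one_add_pow_mul_one_sub_pow a b τ).mul
    ((hasDerivAt_log_one_add_sub_log_one_sub hτ).const_mul k))
  rw [(hd.congr_of_eventuallyEq (Filter.eventuallyEq_of_mem (Ioo_mem_nhds hτ.1 hτ.2) hP)).deriv]
  simp only [eval_add, eval_mul, eval_sub, eval_C, eval_one, eval_pow, eval_X]
  field_simp
  ring

/-- Uniqueness of the zero solution of the system satisfied by the propagated constraints. -/
theorem eq_zero_of_skew_system {a : ℝ} {u v w : ℝ → ℝ}
    (hu : ∀ τ ∈ Set.Ioo (-1 : ℝ) 1, HasDerivAt u (u τ + a * v τ) τ)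
    (hv : ∀ τ ∈ Set.Ioo (-1 : ℝ) 1, HasDerivAt v (-a * u τ + a * w τ) τ)
    (hw : ∀ τ ∈ Set.Ioo (-1 : ℝ) 1, HasDerivAt w (-w τ - a * v τ) τ)
    (hu0 : u 0 = 0) (hv0 : v 0 = 0) (hw0 : w 0 = 0) :
    ∀ τ ∈ Set.Ioo (-1 : ℝ) 1, u τ = 0 ∧ v τ = 0 ∧ w τ = 0 := by
  set E : ℝ → ℝ := fun t => u t ^ 2 + v t ^ 2 + w t ^ 2 with hE
  have hE0 : E 0 = 0 := by simp [hE, hu0, hv0, hw0]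
  have hd (s : ℝ) : ∀ τ ∈ Set.Ioo (-1 : ℝ) 1, HasDerivAt (fun t => E t * Real.exp (s * t))
      ((2 * u τ ^ 2 - 2 * w τ ^ 2 + s * E τ) * Real.exp (s * τ)) τ := by
    intro τ hτ
    refine HasDerivAt.congr_deriv (((((hu τ hτ).pow 2).add ((hv τ hτ).pow 2)).add
      ((hw τ hτ).pow 2)).mul
      (((hasDerivAt_id τ).const_mul s).exp)) ?_
    simp only [hE, id, Pi.add_apply, Pi.pow_apply]
    ring
  have hint : interior (Set.Ioo (-1 : ℝ) 1) = Set.Ioo (-1 : ℝ) 1 := interior_Ioo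
  have hmono : MonotoneOn (fun t => E t * Real.exp (2 * t)) (Set.Ioo (-1 : ℝ) 1) := by
    refine monotoneOn_of_deriv_nonneg (convex_Ioo _ _)
      (fun τ hτ => (hd 2 τ hτ).continuousAt.continuousWithinAt)
      (fun τ hτ => (hd 2 τ (hint ▸ hτ)).differentiableAt.differentiableWithinAt) fun τ hτ => ?_
    rw [(hd 2 τ (hint ▸ hτ)).deriv]
    refine mul_nonneg ?_ (Real.exp_pos _).le
    simp only [hE]
    nlinarith [sq_nonneg (u τ), sq_nonneg (v τ)]
  have hanti : AntitoneOn (fun t => E t * Real.exp (-2 * t)) (Set.Ioo (-1 : ℝ) 1) := by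
    refine antitoneOn_of_deriv_nonpos (convex_Ioo _ _)
      (fun τ hτ => (hd (-2) τ hτ).continuousAt.continuousWithinAt)
      (fun τ hτ => (hd (-2) τ (hint ▸ hτ)).differentiableAt.differentiableWithinAt) fun τ hτ => ?_
    rw [(hd (-2) τ (hint ▸ hτ)).deriv]
    refine mul_nonpos_of_nonpos_of_nonneg ?_ (Real.exp_pos _).le
    simp only [hE]
    nlinarith [sq_nonneg (w τ), sq_nonneg (v τ)]
  intro τ hτ
  have h0 : (0 : ℝ) ∈ Set.Ioo (-1 : ℝ) 1 := by norm_num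
  have hle : E τ ≤ 0 := by
    rcases le_total 0 τ with h | h
    · have := hanti h0 hτ h
      simp only [hE0, zero_mul] at this
      exact nonpos_of_mul_nonpos_left this (Real.exp_pos _)
    · have := hmono hτ h0 h
      simp only [hE0, zero_mul] at this
      exact nonpos_of_mul_nonpos_left this (Real.exp_pos _)
  simp only [hE] at hle
  refine ⟨?_, ?_, ?_⟩ <;> refine pow_eq_zero_iff two_ne_zero |>.1 ?_ <;>
    nlinarith [sq_nonneg (u τ), sq_nonneg (v τ), sq_nonneg (w τ)]

theorem eq_of_hasDerivAt_zero_Ioo {f : ℝ → ℝ}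
    (hf : ∀ τ ∈ Set.Ioo (-1 : ℝ) 1, HasDerivAt f 0 τ) :
    ∀ τ ∈ Set.Ioo (-1 : ℝ) 1, f τ = f 0 := fun _ hτ =>
  isOpen_Ioo.is_const_of_deriv_eq_zero isPreconnected_Ioo
    (fun t ht => (hf t ht).differentiableAt.differentiableWithinAt)
    (fun t ht => (hf t ht).deriv) hτ (by norm_num)

open Polynomial in
/-- Solutions of `(1 - τ²) f' + 2 m τ f = K` are in logarithmic form, with coefficient
proportional to `K`. -/
theorem exists_hasLogForm_of_first_order (m : ℕ) :
    ∃ b : ℝ, b ≠ 0 ∧ ∀ (f f' : ℝ → ℝ) (K : ℝ),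
      (∀ τ ∈ Set.Ioo (-1 : ℝ) 1, HasDerivAt f (f' τ) τ) →
      (∀ τ ∈ Set.Ioo (-1 : ℝ) 1, (1 - τ ^ 2) * f' τ + 2 * m * τ * f τ = K) →
      HasLogForm m m (K * b) f := by
  obtain ⟨Q, b, hb, hQ⟩ := exists_polynomial_logDefect m
  refine ⟨b, hb, fun f f' K hf hK => ?_⟩
  have hconst := eq_of_hasDerivAt_zero_Ioo
    (f := fun t => (f t - K * Q.eval t) / (1 - t ^ 2) ^ m
      - K * b * (Real.log (1 + t) - Real.log (1 - t))) fun τ hτ => by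
    have h1 : 1 + τ ≠ 0 := by linarith [hτ.1]
    have h2 : 1 - τ ≠ 0 := by linarith [hτ.2]
    have h3 : 1 - τ ^ 2 = (1 + τ) * (1 - τ) := by ring
    have h4 : 1 - τ ^ 2 ≠ 0 := h3 ▸ mul_ne_zero h1 h2
    have hw : HasDerivAt (fun t : ℝ => (1 - t ^ 2) ^ m)
        (-(2 * m * τ) * (1 - τ ^ 2) ^ m / (1 - τ ^ 2)) τ := by
      refine HasDerivAt.congr_deriv ((((hasDerivAt_id τ).pow 2).const_sub 1).pow m) ?_
      rcases m with _ | m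
      · simp
      · simp only [id, Nat.add_sub_cancel, Nat.cast_add, Nat.cast_one, Pi.pow_apply]
        field_simp
        ring
    refine HasDerivAt.congr_deriv ((((hf τ hτ).sub ((Q.hasDerivAt τ).const_mul K)).div
      hw (pow_ne_zero m h4)).sub
      ((hasDerivAt_log_one_add_sub_log_one_sub hτ).const_mul (K * b))) ?_
    have h5 : 1 / (1 + τ) + 1 / (1 - τ) = 2 / (1 - τ ^ 2) := by
      rw [h3]; field_simp; ring
    rw [h5]
    have hp : (1 - τ ^ 2) ^ m ≠ 0 := pow_ne_zero m h4
    simp only [Pi.sub_apply]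
    field_simp
    linear_combination hK τ hτ - K * hQ τ
  set A := (fun t => (f t - K * Q.eval t) / (1 - t ^ 2) ^ m
      - K * b * (Real.log (1 + t) - Real.log (1 - t))) 0
  refine ⟨C K * Q + C A * (1 - X ^ 2) ^ m, fun τ hτ => ?_⟩
  have h3 : 1 - τ ^ 2 = (1 + τ) * (1 - τ) := by ring
  have h4 : 1 - τ ^ 2 ≠ 0 := h3 ▸ mul_ne_zero (by linarith [hτ.1]) (by linarith [hτ.2])
  have h := hconst τ hτ
  simp only [eval_add, eval_mul, eval_sub, eval_C, eval_one, eval_pow, eval_X]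
  rw [← mul_pow, ← h3]
  have hp : (1 - τ ^ 2) ^ m ≠ 0 := pow_ne_zero m h4
  have h' : (f τ - K * Q.eval τ) / (1 - τ ^ 2) ^ m
      = A + K * b * (Real.log (1 + τ) - Real.log (1 - τ)) := by linear_combination h
  rw [div_eq_iff hp] at h'
  linear_combination h'

theorem hasDerivAt_of_contDiffOn_Ioo {f : ℝ → ℝ} (hf : ContDiffOn ℝ 1 f (Set.Ioo (-1 : ℝ) 1)) :
    ∀ τ ∈ Set.Ioo (-1 : ℝ) 1, HasDerivAt f (deriv f τ) τ := fun _ hτ =>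
  ((hf.differentiableOn one_ne_zero).differentiableAt (Ioo_mem_nhds hτ.1 hτ.2)).hasDerivAt

/-- The α-constraints propagate from `τ = 0` to all of `(-1, 1)`. -/
theorem AlphaConstr0.propagate {ℓ : ℕ} {lam0 lam1 : ℝ}
    (hlam : lam0 ^ 2 = lam1 ^ 2 + 2) {α : Fin 5 → ℝ → ℝ}
    (hreg : ∀ n, ContDiffOn ℝ 1 (α n) (Set.Ioo (-1 : ℝ) 1))
    (hev : AlphaEvol ℓ lam0 lam1 α) (hcon : AlphaConstr0 ℓ lam0 lam1 α) :
    ∀ τ ∈ Set.Ioo (-1 : ℝ) 1,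
      ((τ - ℓ) * α 1 τ + lam1 / 2 * ((1 - τ) * α 0 τ) + lam0 / 2 * ((1 + τ) * α 2 τ) = 0) ∧
      (lam0 / 2 * ((1 - τ) * α 1 τ + (1 + τ) * α 3 τ) - ℓ * α 2 τ = 0) ∧
      (lam0 / 2 * ((1 - τ) * α 2 τ) + lam1 / 2 * ((1 + τ) * α 4 τ) - (ℓ + τ) * α 3 τ = 0) := by
  have hd n := hasDerivAt_of_contDiffOn_Ioo (hreg n)
  obtain ⟨hc1, hc2, hc3⟩ := hcon
  have hsub (τ : ℝ) : HasDerivAt (fun t : ℝ => 1 - t) (-1) τ := (hasDerivAt_id τ).const_sub 1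
  have hadd (τ : ℝ) : HasDerivAt (fun t : ℝ => 1 + t) 1 τ := (hasDerivAt_id τ).const_add 1
  refine eq_zero_of_skew_system (a := lam0 / 2)
    (u := fun τ => (τ - ℓ) * α 1 τ + lam1 / 2 * ((1 - τ) * α 0 τ) + lam0 / 2 * ((1 + τ) * α 2 τ))
    (v := fun τ => lam0 / 2 * ((1 - τ) * α 1 τ + (1 + τ) * α 3 τ) - ℓ * α 2 τ)
    (w := fun τ =>
      lam0 / 2 * ((1 - τ) * α 2 τ) + lam1 / 2 * ((1 + τ) * α 4 τ) - (ℓ + τ) * α 3 τ)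
    (fun τ hτ => ?_) (fun τ hτ => ?_) (fun τ hτ => ?_)
    (by linear_combination hc1) (by linear_combination hc2) (by linear_combination hc3) <;>
    obtain ⟨h0, h1, h2, h3, h4⟩ := hev τ hτ
  · refine HasDerivAt.congr_deriv (((((hasDerivAt_id τ).sub_const (ℓ : ℝ)).mul (hd 1 τ hτ)).add
      (((hsub τ).mul (hd 0 τ hτ)).const_mul (lam1 / 2))).add
      (((hadd τ).mul (hd 2 τ hτ)).const_mul (lam0 / 2))) ?_
    simp only [id]
    linear_combination (τ - ℓ) * h1 + lam1 / 2 * h0 + lam0 / 2 * (1 + τ) * h2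
      - α 1 τ / 2 * hlam
  · refine HasDerivAt.congr_deriv (((((hsub τ).mul (hd 1 τ hτ)).add
      ((hadd τ).mul (hd 3 τ hτ))).const_mul (lam0 / 2)).sub ((hd 2 τ hτ).const_mul (ℓ : ℝ))) ?_
    linear_combination lam0 / 2 * (1 - τ) * h1 + lam0 / 2 * (1 + τ) * h3 - ℓ * h2
  · refine HasDerivAt.congr_deriv (((((hsub τ).mul (hd 2 τ hτ)).const_mul (lam0 / 2)).add
      (((hadd τ).mul (hd 4 τ hτ)).const_mul (lam1 / 2))).sub
      (((hasDerivAt_id τ).const_add (ℓ : ℝ)).mul (hd 3 τ hτ))) ?_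
    simp only [id]
    linear_combination lam1 / 2 * h4 + lam0 / 2 * (1 - τ) * h2 - (ℓ + τ) * h3
      + α 3 τ / 2 * hlam

/-- Proposition 1(iii): a C¹ constrained solution of the α-evolution
system splits as a polynomial part plus a singular part
`(1+τ)^{ℓ+2−n}(1−τ)^{ℓ−2+n}(c_n ln(1−τ) + d_n ln(1+τ))`, and all the logarithmic
constants vanish iff `α₀(0) = α₄(0)`. -/
theorem alpha_log_structure (ℓ : ℕ) (hℓ : 2 ≤ ℓ) (lam0 lam1 : ℝ)
    (hlam0 : lam0 = Real.sqrt ((ℓ : ℝ) * ((ℓ : ℝ) + 1)))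
    (hlam1 : lam1 = Real.sqrt (((ℓ : ℝ) - 1) * ((ℓ : ℝ) + 2)))
    (α : Fin 5 → ℝ → ℝ)
    (hreg : ∀ n, ContDiffOn ℝ 1 (α n) (Set.Ioo (-1 : ℝ) 1))
    (hev : AlphaEvol ℓ lam0 lam1 α)
    (hcon : AlphaConstr0 ℓ lam0 lam1 α) :
    ∃ (p : Fin 5 → Polynomial ℝ) (c d : Fin 5 → ℝ),
      (∀ n : Fin 5, ∀ τ ∈ Set.Ioo (-1 : ℝ) 1,
        α n τ = (p n).eval τ
          + (1 + τ) ^ (ℓ + 2 - (n : ℕ)) * (1 - τ) ^ (ℓ - 2 + (n : ℕ))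
            * (c n * Real.log (1 - τ) + d n * Real.log (1 + τ))) ∧
      ((∀ n, c n = 0 ∧ d n = 0) ↔ α 0 0 = α 4 0) := by
  obtain ⟨m, rfl⟩ : ∃ m, ℓ = m + 2 := ⟨ℓ - 2, by omega⟩
  have hm : (0 : ℝ) ≤ m := m.cast_nonneg
  push_cast at hlam0 hlam1
  have hpos0 : 0 < lam0 := hlam0 ▸ Real.sqrt_pos.2 (by positivity)
  have hpos1 : 0 < lam1 := hlam1 ▸ Real.sqrt_pos.2 (by nlinarith)
  have hsq0 : lam0 ^ 2 = (m + 2) * (m + 3) := by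
    rw [hlam0, Real.sq_sqrt (by positivity)]; ring
  have hsq1 : lam1 ^ 2 = (m + 1) * (m + 4) := by
    rw [hlam1, Real.sq_sqrt (by nlinarith)]; ring
  have hd n := hasDerivAt_of_contDiffOn_Ioo (hreg n)
  have hprop := hcon.propagate (by rw [hsq0, hsq1]; ring) hreg hev
  push_cast at hprop
  set K := lam0 / 2 * (α 3 0 - α 1 0) with hKdef
  have hK : ∀ τ ∈ Set.Ioo (-1 : ℝ) 1,
      (1 - τ ^ 2) * deriv (α 2) τ + 2 * (m + 2 : ℕ) * τ * α 2 τ = K := by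
    intro τ hτ
    have hconst := eq_of_hasDerivAt_zero_Ioo
      (f := fun t => (1 - t ^ 2) * (lam0 / 2 * (α 3 t - α 1 t)) + 2 * (m + 2) * (t * α 2 t))
      (fun t ht => by
        obtain ⟨-, h1, h2, h3, -⟩ := hev t ht
        obtain ⟨c1, c2, c3⟩ := hprop t ht
        refine HasDerivAt.congr_deriv (((((hasDerivAt_id t).pow 2).const_sub 1).mul
          (((hd 3 t ht).sub (hd 1 t ht)).const_mul (lam0 / 2))).add
          (((hasDerivAt_id t).mul (hd 2 t ht)).const_mul (2 * (m + 2 : ℝ)))) ?_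
        simp only [id, Pi.sub_apply, Pi.pow_apply]
        rw [h1, h2, h3]
        linear_combination lam0 / 2 * ((1 - t) * c3 + (1 + t) * c1) + (m + 1) * c2
          - α 2 t * hsq0) τ hτ
    rw [(hev τ hτ).2.2.1]
    push_cast
    simp only [← hKdef] at hconst
    linear_combination hconst
  obtain ⟨b, hb, hform⟩ := exists_hasLogForm_of_first_order (m + 2)
  have form2 := hform _ _ K (hd 2) hK
  obtain ⟨P2, hP2⟩ := id form2
  obtain ⟨R2, hR2⟩ := form2.exists_deriv
  have form1 : HasLogForm (m + 3) (m + 1) ((m + 2) / lam0 * (K * b)) (α 1) := by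
    refine ⟨Polynomial.C (1 / lam0) * (Polynomial.C (m + 2 : ℝ) * P2 - (1 + Polynomial.X) * R2), fun τ hτ => ?_⟩
    have h2 := (hev τ hτ).2.2.1
    have c2 := (hprop τ hτ).2.1
    have h2' := hP2 τ hτ
    have hr := hR2 τ hτ
    simp only [Polynomial.eval_add, Polynomial.eval_mul, Polynomial.eval_sub,
      Polynomial.eval_C, Polynomial.eval_one, Polynomial.eval_X]
    have : lam0 * α 1 τ = (m + 2) * α 2 τ - (1 + τ) * deriv (α 2) τ := by
      linear_combination c2 + (1 + τ) * h2
    rw [hr, h2'] at this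
    field_simp
    push_cast at this
    linear_combination this
  have form3 : HasLogForm (m + 1) (m + 3) ((m + 2) / lam0 * (K * b)) (α 3) := by
    refine ⟨Polynomial.C (1 / lam0) * (Polynomial.C (m + 2 : ℝ) * P2 + (1 - Polynomial.X) * R2), fun τ hτ => ?_⟩
    have h2 := (hev τ hτ).2.2.1
    have c2 := (hprop τ hτ).2.1
    have h2' := hP2 τ hτ
    have hr := hR2 τ hτ
    simp only [Polynomial.eval_add, Polynomial.eval_mul, Polynomial.eval_sub,
      Polynomial.eval_C, Polynomial.eval_one, Polynomial.eval_X]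
    have : lam0 * α 3 τ = (m + 2) * α 2 τ + (1 - τ) * deriv (α 2) τ := by
      linear_combination c2 - (1 - τ) * h2
    rw [hr, h2'] at this
    field_simp
    push_cast at this
    linear_combination this
  obtain ⟨P1, hP1⟩ := id form1
  obtain ⟨R1, hR1⟩ := form1.exists_deriv
  obtain ⟨P3, hP3⟩ := id form3
  obtain ⟨R3, hR3⟩ := form3.exists_deriv
  have form0 : HasLogForm (m + 4) m ((m + 1) * (m + 2) / (lam0 * lam1) * (K * b)) (α 0) := by
    refine ⟨Polynomial.C (2 / lam1) * (P1 - R1 + Polynomial.C (lam0 / 2) * P2), fun τ hτ => ?_⟩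
    have h1 := (hev τ hτ).2.1
    simp only [Polynomial.eval_add, Polynomial.eval_mul, Polynomial.eval_sub, Polynomial.eval_C]
    have : lam1 * α 0 τ = 2 * (α 1 τ - deriv (α 1) τ + lam0 / 2 * α 2 τ) := by
      linear_combination 2 * h1
    rw [hR1 τ hτ, hP1 τ hτ, hP2 τ hτ] at this
    field_simp at this ⊢
    push_cast at this
    linear_combination this + (1 + τ) ^ (m + 2) * (1 - τ) ^ (m + 2) * K * b
      * (Real.log (1 + τ) - Real.log (1 - τ)) * hsq0
  have form4 : HasLogForm m (m + 4) ((m + 1) * (m + 2) / (lam0 * lam1) * (K * b)) (α 4) := by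
    refine ⟨Polynomial.C (2 / lam1) * (P3 + R3 + Polynomial.C (lam0 / 2) * P2), fun τ hτ => ?_⟩
    have h3 := (hev τ hτ).2.2.2.1
    simp only [Polynomial.eval_add, Polynomial.eval_mul, Polynomial.eval_C]
    have : lam1 * α 4 τ = 2 * (α 3 τ + deriv (α 3) τ + lam0 / 2 * α 2 τ) := by
      linear_combination -2 * h3
    rw [hR3 τ hτ, hP3 τ hτ, hP2 τ hτ] at this
    field_simp at this ⊢
    push_cast at this
    linear_combination this + (1 + τ) ^ (m + 2) * (1 - τ) ^ (m + 2) * K * b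
      * (Real.log (1 + τ) - Real.log (1 - τ)) * hsq0
  obtain ⟨P0, hP0⟩ := form0
  obtain ⟨P4, hP4⟩ := form4
  let e : Fin 5 → ℝ := ![(m + 1) * (m + 2) / (lam0 * lam1), (m + 2) / lam0, 1, (m + 2) / lam0,
    (m + 1) * (m + 2) / (lam0 * lam1)]
  have hK0 : K = 0 ↔ α 0 0 = α 4 0 := by
    obtain ⟨c1, -, c3⟩ := hcon
    push_cast at c1 c3
    have key : 2 * (m + 2) * K = lam0 * lam1 / 2 * (α 4 0 - α 0 0) := by
      rw [hKdef]
      linear_combination lam0 * (c1 - c3)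
    have hl : lam0 * lam1 / 2 ≠ 0 := by positivity
    have hm2 : (2 * (m + 2) : ℝ) ≠ 0 := by positivity
    constructor
    · intro h
      rw [h, mul_zero, eq_comm, mul_eq_zero, or_iff_right hl] at key
      linarith
    · intro h
      rw [h, sub_self, mul_zero, mul_eq_zero, or_iff_right hm2] at key
      exact key
  refine ⟨![P0, P1, P2, P3, P4], fun n => -(e n * (K * b)), fun n => e n * (K * b), ?_, ?_⟩
  · intro n τ hτ
    fin_cases n
    · simpa [e] using (hP0 τ hτ).trans (by ring)
    · simpa [e] using (hP1 τ hτ).trans (by ring)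
    · simpa [e] using (hP2 τ hτ).trans (by ring)
    · simpa [e] using (hP3 τ hτ).trans (by ring)
    · simpa [e] using (hP4 τ hτ).trans (by ring)
  · rw [← hK0]
    constructor
    · intro h
      simpa [e, hb] using (h 2).2
    · intro h n
      simp [h]
end

section
/- Let ℓ = 2, so λ₀ = √6 and λ₁ = 2. Let α₀,…,α₄ : (−1,1) → ℝ be C¹ functions satisfying the α-evolution system on (−1,1) and the α-constraints at τ = 0. Then there exists a constant K ∈ ℝ such that the functions τ ↦ α₀(τ) − K(1 − 2(1−τ))ln(1−τ) and τ ↦ α₁(τ) − K(1−τ)ln(1−τ) extend to C¹ functions on (−1,1], and α₂, α₃, α₄ extend to C¹ functions on (−1,1]. -/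
open Set Filter Topology

/-- A function on `(a,b)` whose derivative is `O((b - x)^(-1/2))` has a limit at `b`, which it
approaches at rate `(b - x)^(1/2)`. -/
theorem exists_tendsto_of_abs_deriv_le_div_sqrt {a b C : ℝ} (hab : a < b) {f f' : ℝ → ℝ}
    (hf : ∀ x ∈ Ioo a b, HasDerivAt f (f' x) x)
    (hf' : ∀ x ∈ Ioo a b, |f' x| ≤ C / √(b - x)) :
    ∃ l, Tendsto f (𝓝[<] b) (𝓝 l) ∧ ∀ x ∈ Ioo a b, |f x - l| ≤ 2 * C * √(b - x) := by
  have hsqrt : ∀ x ∈ Ioo a b,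
      HasDerivAt (fun y => 2 * C * √(b - y)) (-(C / √(b - x))) x := by
    intro x hx
    have hpos : 0 < b - x := sub_pos.2 hx.2
    refine ((((hasDerivAt_id x).const_sub b).sqrt hpos.ne').const_mul (2 * C)).congr_deriv ?_
    have := (Real.sqrt_pos.2 hpos).ne'
    simp only [id]
    field_simp
  have hlow := fun x hx => (hf x hx).sub (hsqrt x hx)
  have hupp := fun x hx => (hf x hx).add (hsqrt x hx)
  have hmono : MonotoneOn (f - fun y => 2 * C * √(b - y)) (Ioo a b) := by
    refine monotoneOn_of_deriv_nonneg (convex_Ioo a b)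
      (fun x hx => (hlow x hx).continuousAt.continuousWithinAt) ?_ ?_ <;>
      rw [interior_Ioo] <;> intro x hx
    · exact (hlow x hx).differentiableAt.differentiableWithinAt
    · rw [(hlow x hx).deriv]
      linarith [(abs_le.1 (hf' x hx)).1]
  have hanti : AntitoneOn (f + fun y => 2 * C * √(b - y)) (Ioo a b) := by
    refine antitoneOn_of_deriv_nonpos (convex_Ioo a b)
      (fun x hx => (hupp x hx).continuousAt.continuousWithinAt) ?_ ?_ <;>
      rw [interior_Ioo] <;> intro x hx
    · exact (hupp x hx).differentiableAt.differentiableWithinAt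
    · rw [(hupp x hx).deriv]
      linarith [(abs_le.1 (hf' x hx)).2]
  have hC : 0 ≤ C := by
    obtain ⟨m, hm⟩ := nonempty_Ioo.2 hab
    have hpos := Real.sqrt_pos.2 (sub_pos.2 hm.2)
    simpa [hpos.ne'] using mul_nonneg ((abs_nonneg _).trans (hf' m hm)) hpos.le
  have hbdd : BddAbove ((f - fun y => 2 * C * √(b - y)) '' Ioo a b) := by
    obtain ⟨m, hm⟩ := nonempty_Ioo.2 hab
    refine ⟨(f + fun y => 2 * C * √(b - y)) m, ?_⟩
    rintro _ ⟨x, hx, rfl⟩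
    have hmax : max x m ∈ Ioo a b := ⟨lt_max_of_lt_left hx.1, max_lt hx.2 hm.2⟩
    have h₁ := hmono hx hmax (le_max_left _ _)
    have h₂ := hanti hm hmax (le_max_right _ _)
    simp only [Pi.add_apply, Pi.sub_apply] at h₁ h₂ ⊢
    have := mul_nonneg (mul_nonneg zero_le_two hC) (Real.sqrt_nonneg (b - max x m))
    linarith
  have hlim := hmono.tendsto_nhdsWithin_Ioo_left (nonempty_Ioo.2 hab) hbdd
  set l := sSup ((f - fun y => 2 * C * √(b - y)) '' Ioo a b)
  have hzero : Tendsto (fun y => 2 * C * √(b - y)) (𝓝[<] b) (𝓝 0) := by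
    have : ContinuousAt (fun y => 2 * C * √(b - y)) b := by fun_prop
    simpa using this.tendsto.mono_left nhdsWithin_le_nhds
  have hf_lim : Tendsto f (𝓝[<] b) (𝓝 l) := by simpa using hlim.add hzero
  have hupp_lim : Tendsto (f + fun y => 2 * C * √(b - y)) (𝓝[<] b) (𝓝 l) := by
    rw [← add_zero l]
    exact hf_lim.add hzero
  refine ⟨l, hf_lim, fun x hx => ?_⟩
  have hev : ∀ᶠ y in 𝓝[<] b, y ∈ Ioo x b := Ioo_mem_nhdsLT hx.2
  have h₁ : (f - fun y => 2 * C * √(b - y)) x ≤ l := ge_of_tendsto hlim <| hev.mono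
    fun y hy => hmono hx ⟨hx.1.trans hy.1, hy.2⟩ hy.1.le
  have h₂ : l ≤ (f + fun y => 2 * C * √(b - y)) x := le_of_tendsto hupp_lim <| hev.mono
    fun y hy => hanti hx ⟨hx.1.trans hy.1, hy.2⟩ hy.1.le
  simp only [Pi.add_apply, Pi.sub_apply] at h₁ h₂
  rw [abs_le]
  constructor <;> linarith

/-- A `C¹` function on `(a,b)` with limits of the function and of its derivative at `b` extends to
a `C¹` function on `(a,b]`. -/
theorem exists_contDiffOn_Ioc_of_tendsto {a b l L : ℝ} (hab : a < b) {f f' : ℝ → ℝ}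
    (hreg : ContDiffOn ℝ 1 f (Ioo a b)) (hf : ∀ x ∈ Ioo a b, HasDerivAt f (f' x) x)
    (hl : Tendsto f (𝓝[<] b) (𝓝 l)) (hL : Tendsto f' (𝓝[<] b) (𝓝 L)) :
    ∃ g : ℝ → ℝ, ContDiffOn ℝ 1 g (Ioc a b) ∧ EqOn g f (Ioo a b) ∧ g b = l ∧
      HasDerivWithinAt g L (Iic b) b := by
  have hupdate : ∀ {u : ℝ → ℝ} {c : ℝ}, ContinuousOn u (Ioo a b) →
      Tendsto u (𝓝[<] b) (𝓝 c) → ContinuousOn (Function.update u b c) (Ioc a b) := by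
    intro u c hu hc
    rw [continuousOn_update_iff, Ioc_sdiff_right]
    exact ⟨hu, fun _ => hc.mono_left (nhdsWithin_mono _ Ioo_subset_Iio_self)⟩
  set g := Function.update f b l
  have hgb : g b = l := by simp [g]
  have hgf : EqOn g f (Ioo a b) := fun x hx => by simp [g, hx.2.ne]
  have hg : ∀ x ∈ Ioo a b, HasDerivAt g (f' x) x := fun x hx =>
    (hf x hx).congr_of_eventuallyEq (hgf.eventuallyEq_of_mem (isOpen_Ioo.mem_nhds hx))
  have hg_cont : ContinuousOn g (Ioc a b) := hupdate hreg.continuousOn hl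
  have hgL : HasDerivWithinAt g L (Iic b) b := by
    refine hasDerivWithinAt_Iic_of_tendsto_deriv (s := Ioo a b)
      (fun x hx => (hg x hx).differentiableAt.differentiableWithinAt)
      ((hg_cont b ⟨hab, le_rfl⟩).mono Ioo_subset_Ioc_self) (Ioo_mem_nhdsLT hab) (hL.congr' ?_)
    filter_upwards [Ioo_mem_nhdsLT hab] with x hx using (hg x hx).deriv.symm
  have hg_within : ∀ x ∈ Ioc a b,
      HasDerivWithinAt g (Function.update f' b L x) (Ioc a b) x := by
    intro x hx
    rcases hx.2.eq_or_lt with rfl | hlt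
    · simpa using hgL.mono Ioc_subset_Iic_self
    · simpa [hlt.ne] using (hg x ⟨hx.1, hlt⟩).hasDerivWithinAt
  have hf'_cont : ContinuousOn f' (Ioo a b) :=
    (hreg.continuousOn_deriv_of_isOpen isOpen_Ioo le_rfl).congr fun x hx => (hf x hx).deriv.symm
  refine ⟨g, ?_, hgf, hgb, hgL⟩
  rw [show (1 : WithTop ℕ∞) = 0 + 1 from rfl,
    contDiffOn_succ_iff_derivWithin (uniqueDiffOn_Ioc a b)]
  refine ⟨fun x hx => (hg_within x hx).differentiableWithinAt, by simp, ?_⟩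
  rw [contDiffOn_zero]
  exact (hupdate hf'_cont hL).congr fun x hx =>
    (hg_within x hx).derivWithin (uniqueDiffOn_Ioc a b x hx)

/-- Weighted energy estimate for the `ℓ = 2` system: `α₁, …, α₄` stay bounded and `α₀` grows at
most like `(1 - τ)^(-1/2)` at `τ = 1`. -/
theorem exists_energy_bound {r : ℝ} {a₀ a₁ a₂ a₃ a₄ : ℝ → ℝ}
    (h₀ : ∀ τ ∈ Ioo (-1 : ℝ) 1, HasDerivAt a₀ (2 * a₁ τ / (1 - τ)) τ)
    (h₁ : ∀ τ ∈ Ioo (-1 : ℝ) 1, HasDerivAt a₁ (a₁ τ - a₀ τ + r * a₂ τ) τ)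
    (h₂ : ∀ τ ∈ Ioo (-1 : ℝ) 1, HasDerivAt a₂ (-r * a₁ τ + r * a₃ τ) τ)
    (h₃ : ∀ τ ∈ Ioo (-1 : ℝ) 1, HasDerivAt a₃ (-a₃ τ - r * a₂ τ + a₄ τ) τ)
    (h₄ : ∀ τ ∈ Ioo (-1 : ℝ) 1, HasDerivAt a₄ (-2 * a₃ τ / (1 + τ)) τ) :
    ∃ M, ∀ τ ∈ Ico (0 : ℝ) 1,
      (1 - τ) * a₀ τ ^ 2 + a₁ τ ^ 2 + a₂ τ ^ 2 + a₃ τ ^ 2 + a₄ τ ^ 2 ≤ M := by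
  set E : ℝ → ℝ := fun τ =>
    (1 - τ) * a₀ τ ^ 2 + a₁ τ ^ 2 + a₂ τ ^ 2 + a₃ τ ^ 2 + a₄ τ ^ 2 with hE
  set D : ℝ → ℝ := fun τ => -a₀ τ ^ 2 + 2 * a₀ τ * a₁ τ + 2 * a₁ τ ^ 2 - 2 * a₃ τ ^ 2
    + (2 - 4 / (1 + τ)) * (a₃ τ * a₄ τ) with hD
  have hsub : Ico (0 : ℝ) 1 ⊆ Ioo (-1) 1 := fun τ hτ => ⟨by linarith [hτ.1], hτ.2⟩
  have hE' : ∀ τ ∈ Ico (0 : ℝ) 1, HasDerivAt E (D τ) τ := by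
    intro τ hτ
    have hτ' := hsub hτ
    have hs : 1 - τ ≠ 0 := by linarith [hτ.2]
    have hp : 1 + τ ≠ 0 := by linarith [hτ.1]
    refine ((((((hasDerivAt_id τ).const_sub 1).mul ((h₀ τ hτ').pow 2)).add
      ((h₁ τ hτ').pow 2)).add ((h₂ τ hτ').pow 2)).add ((h₃ τ hτ').pow 2)).add
      ((h₄ τ hτ').pow 2) |>.congr_deriv ?_
    simp only [hD, id, Pi.pow_apply]
    field_simp
    push_cast
    ring
  have hle : ∀ τ ∈ Ico (0 : ℝ) 1, D τ ≤ 3 * E τ := by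
    intro τ hτ
    have hc₀ : 4 / (1 + τ) ≤ 4 := div_le_self (by norm_num) (by linarith [hτ.1])
    have hc₁ : 2 ≤ 4 / (1 + τ) := by
      rw [le_div_iff₀ (by linarith [hτ.1])]; linarith [hτ.2]
    have hcross : (2 - 4 / (1 + τ)) * (a₃ τ * a₄ τ) ≤ a₃ τ ^ 2 + a₄ τ ^ 2 := by
      nlinarith [mul_nonneg (sub_nonneg.2 hc₀) (sq_nonneg (a₃ τ - a₄ τ)),
        mul_nonneg (sub_nonneg.2 hc₁) (sq_nonneg (a₃ τ + a₄ τ)),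
        mul_nonneg (sub_nonneg.2 hc₀) (sq_nonneg (a₃ τ + a₄ τ)),
        mul_nonneg (sub_nonneg.2 hc₁) (sq_nonneg (a₃ τ - a₄ τ))]
    have hweight := mul_nonneg (sub_nonneg.2 hτ.2.le) (sq_nonneg (a₀ τ))
    simp only [hD, hE]
    nlinarith [sq_nonneg (a₀ τ - a₁ τ), sq_nonneg (a₂ τ), sq_nonneg (a₃ τ), sq_nonneg (a₄ τ)]
  have hF : ∀ τ ∈ Ico (0 : ℝ) 1, HasDerivAt (fun t => E t * Real.exp (-3 * t))
      ((D τ - 3 * E τ) * Real.exp (-3 * τ)) τ := by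
    intro τ hτ
    refine ((hE' τ hτ).mul ((hasDerivAt_id τ).const_mul (-3)).exp).congr_deriv ?_
    simp only [id]
    ring
  have hanti : AntitoneOn (fun t => E t * Real.exp (-3 * t)) (Ico (0 : ℝ) 1) := by
    refine antitoneOn_of_deriv_nonpos (convex_Ico 0 1)
      (fun x hx => (hF x hx).continuousAt.continuousWithinAt) ?_ ?_ <;>
      intro x hx <;> have hx' := interior_subset hx
    · exact (hF x hx').differentiableAt.differentiableWithinAt
    · rw [(hF x hx').deriv]
      exact mul_nonpos_of_nonpos_of_nonneg (by linarith [hle x hx']) (Real.exp_pos _).le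
  refine ⟨E 0 * Real.exp 3, fun τ hτ => ?_⟩
  have hE₀ : 0 ≤ E 0 := by simp only [hE]; norm_num; positivity
  have h := hanti ⟨le_rfl, one_pos⟩ hτ hτ.1
  simp only [mul_zero, Real.exp_zero, mul_one] at h
  have hexp : Real.exp (-3 * τ) * Real.exp (3 * τ) = 1 := by
    rw [← Real.exp_add]; simp
  calc E τ = E τ * Real.exp (-3 * τ) * Real.exp (3 * τ) := by rw [mul_assoc, hexp, mul_one]
    _ ≤ E 0 * Real.exp (3 * τ) := by gcongr
    _ ≤ E 0 * Real.exp 3 := by gcongr; linarith [hτ.2]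


/-- `ℓ = 2`, `λ₀ = √6`, `λ₁ = 2`: there is a constant `K` such that
`α₀ − K(1 − 2(1−τ))ln(1−τ)` and `α₁ − K(1−τ)ln(1−τ)` extend to C¹ functions on `(−1,1]`,
and `α₂, α₃, α₄` extend to C¹ functions on `(−1,1]`. -/
theorem alpha_C1_extension_l2 (lam0 lam1 : ℝ)
    (hlam0 : lam0 = Real.sqrt 6) (hlam1 : lam1 = 2)
    (α : Fin 5 → ℝ → ℝ)
    (hreg : ∀ n, ContDiffOn ℝ 1 (α n) (Set.Ioo (-1 : ℝ) 1))
    (hev : AlphaEvol 2 lam0 lam1 α)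
    (hcon : AlphaConstr0 2 lam0 lam1 α) :
    ∃ K : ℝ,
      (∃ g : ℝ → ℝ, ContDiffOn ℝ 1 g (Set.Ioc (-1 : ℝ) 1) ∧
        ∀ τ ∈ Set.Ioo (-1 : ℝ) 1,
          g τ = α 0 τ - K * (1 - 2 * (1 - τ)) * Real.log (1 - τ)) ∧
      (∃ g : ℝ → ℝ, ContDiffOn ℝ 1 g (Set.Ioc (-1 : ℝ) 1) ∧
        ∀ τ ∈ Set.Ioo (-1 : ℝ) 1,
          g τ = α 1 τ - K * (1 - τ) * Real.log (1 - τ)) ∧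
      (∀ n : Fin 5, 2 ≤ (n : ℕ) →
        ∃ g : ℝ → ℝ, ContDiffOn ℝ 1 g (Set.Ioc (-1 : ℝ) 1) ∧
          ∀ τ ∈ Set.Ioo (-1 : ℝ) 1, g τ = α n τ) := by
  subst hlam0 hlam1
  set r := √6 / 2 with hr
  have hr₀ : 0 ≤ r := by positivity
  have hα : ∀ n, ∀ τ ∈ Ioo (-1 : ℝ) 1, HasDerivAt (α n) (deriv (α n) τ) τ := fun n τ hτ =>
    (((hreg n).differentiableOn one_ne_zero).differentiableAt
      (isOpen_Ioo.mem_nhds hτ)).hasDerivAt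
  have h₀ : ∀ τ ∈ Ioo (-1 : ℝ) 1, HasDerivAt (α 0) (2 * α 1 τ / (1 - τ)) τ := by
    intro τ hτ
    refine (hα 0 τ hτ).congr_deriv ?_
    have h := (hev τ hτ).1
    rw [eq_div_iff (sub_pos.2 hτ.2).ne']
    push_cast at h
    linarith
  have h₁ : ∀ τ ∈ Ioo (-1 : ℝ) 1, HasDerivAt (α 1) (α 1 τ - α 0 τ + r * α 2 τ) τ := by
    intro τ hτ
    refine (hα 1 τ hτ).congr_deriv ?_
    rw [(hev τ hτ).2.1, hr]
    ring
  have h₂ : ∀ τ ∈ Ioo (-1 : ℝ) 1, HasDerivAt (α 2) (-r * α 1 τ + r * α 3 τ) τ :=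
    fun τ hτ => (hα 2 τ hτ).congr_deriv (hev τ hτ).2.2.1
  have h₃ : ∀ τ ∈ Ioo (-1 : ℝ) 1, HasDerivAt (α 3) (-α 3 τ - r * α 2 τ + α 4 τ) τ := by
    intro τ hτ
    refine (hα 3 τ hτ).congr_deriv ?_
    rw [(hev τ hτ).2.2.2.1, hr]
    ring
  have h₄ : ∀ τ ∈ Ioo (-1 : ℝ) 1, HasDerivAt (α 4) (-2 * α 3 τ / (1 + τ)) τ := by
    intro τ hτ
    refine (hα 4 τ hτ).congr_deriv ?_
    have h := (hev τ hτ).2.2.2.2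
    rw [eq_div_iff (by linarith [hτ.1])]
    push_cast at h
    linarith
  obtain ⟨M, hM⟩ := exists_energy_bound h₀ h₁ h₂ h₃ h₄
  have hbound : ∀ τ ∈ Ioo (0 : ℝ) 1, ∀ n, |α n τ| ≤ √M / √(1 - τ) := by
    intro τ hτ n
    have hs : 0 < 1 - τ := sub_pos.2 hτ.2
    have h := hM τ ⟨hτ.1.le, hτ.2⟩
    rw [← Real.sqrt_div' _ hs.le]
    apply Real.abs_le_sqrt
    rw [le_div_iff₀ hs]
    have hshrink : ∀ n, α n τ ^ 2 * (1 - τ) ≤ α n τ ^ 2 := fun n =>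
      mul_le_of_le_one_right (sq_nonneg _) (by linarith [hτ.1])
    have hweight := mul_nonneg hs.le (sq_nonneg (α 0 τ))
    fin_cases n <;> simp only [Fin.zero_eta, Fin.mk_one, Fin.reduceFinMk] <;>
      linarith [hshrink 1, hshrink 2, hshrink 3, hshrink 4, sq_nonneg (α 1 τ),
        sq_nonneg (α 2 τ), sq_nonneg (α 3 τ), sq_nonneg (α 4 τ)]
  have hsub : ∀ τ ∈ Ioo (0 : ℝ) 1, τ ∈ Ioo (-1 : ℝ) 1 := fun τ hτ =>
    ⟨by linarith [hτ.1], hτ.2⟩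
  have hmul : ∀ τ ∈ Ioo (0 : ℝ) 1, ∀ n, |r * α n τ| ≤ r * (√M / √(1 - τ)) := by
    intro τ hτ n
    rw [abs_mul, abs_of_nonneg hr₀]
    exact mul_le_mul_of_nonneg_left (hbound τ hτ n) hr₀
  obtain ⟨l₁, hl₁, hrate⟩ := exists_tendsto_of_abs_deriv_le_div_sqrt (C := (2 + r) * √M) one_pos
    (fun τ hτ => h₁ τ (hsub τ hτ)) fun τ hτ => by
      rw [mul_div_assoc, abs_le]
      have b₀ := abs_le.1 (hbound τ hτ 0)
      have b₁ := abs_le.1 (hbound τ hτ 1)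
      have b₂ := abs_le.1 (hmul τ hτ 2)
      constructor <;> linarith [b₀.1, b₀.2, b₁.1, b₁.2, b₂.1, b₂.2]
  obtain ⟨l₂, hl₂, -⟩ := exists_tendsto_of_abs_deriv_le_div_sqrt (C := (2 * r) * √M) one_pos
    (fun τ hτ => h₂ τ (hsub τ hτ)) fun τ hτ => by
      rw [mul_div_assoc, abs_le]
      have b₁ := abs_le.1 (hmul τ hτ 1)
      have b₃ := abs_le.1 (hmul τ hτ 3)
      constructor <;> linarith [b₁.1, b₁.2, b₃.1, b₃.2]
  obtain ⟨l₃, hl₃, -⟩ := exists_tendsto_of_abs_deriv_le_div_sqrt (C := (2 + r) * √M) one_pos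
    (fun τ hτ => h₃ τ (hsub τ hτ)) fun τ hτ => by
      rw [mul_div_assoc, abs_le]
      have b₂ := abs_le.1 (hmul τ hτ 2)
      have b₃ := abs_le.1 (hbound τ hτ 3)
      have b₄ := abs_le.1 (hbound τ hτ 4)
      constructor <;> linarith [b₂.1, b₂.2, b₃.1, b₃.2, b₄.1, b₄.2]
  obtain ⟨l₄, hl₄, -⟩ := exists_tendsto_of_abs_deriv_le_div_sqrt (C := 2 * √M) one_pos
    (fun τ hτ => h₄ τ (hsub τ hτ)) fun τ hτ => by
      have hp : 1 ≤ 1 + τ := by linarith [hτ.1]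
      rw [mul_div_assoc, mul_div_assoc, abs_mul, abs_div, abs_neg, abs_two,
        abs_of_nonneg (zero_le_one.trans hp)]
      refine mul_le_mul_of_nonneg_left ?_ zero_le_two
      exact (div_le_self (abs_nonneg _) hp).trans (hbound τ hτ 3)
  have hlog : ∀ τ ∈ Ioo (-1 : ℝ) 1,
      HasDerivAt (fun t => Real.log (1 - t)) (-1 / (1 - τ)) τ := fun τ hτ =>
    ((hasDerivAt_id τ).const_sub 1).log (sub_pos.2 hτ.2).ne'
  have hlog_reg : ContDiffOn ℝ 1 (fun t => Real.log (1 - t)) (Ioo (-1 : ℝ) 1) :=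
    (contDiffOn_const.sub contDiffOn_id).log fun τ hτ => (sub_pos.2 hτ.2).ne'
  have hslog : Tendsto (fun t : ℝ => (1 - t) * Real.log (1 - t)) (𝓝[<] 1) (𝓝 0) := by
    have : Continuous fun t : ℝ => (1 - t) * Real.log (1 - t) :=
      Real.continuous_mul_log.comp (continuous_const.sub continuous_id)
    simpa using (this.tendsto 1).mono_left nhdsWithin_le_nhds
  obtain ⟨l₀, hl₀, -⟩ := exists_tendsto_of_abs_deriv_le_div_sqrt
    (C := 4 * ((2 + r) * √M)) one_pos
    (fun τ hτ => (h₀ τ (hsub τ hτ)).add ((hlog τ (hsub τ hτ)).const_mul (2 * l₁)))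
    fun τ hτ => by
      have hs : 0 < 1 - τ := sub_pos.2 hτ.2
      have hq := Real.sqrt_pos.2 hs
      have heq : 2 * α 1 τ / (1 - τ) + 2 * l₁ * (-1 / (1 - τ)) = 2 * (α 1 τ - l₁) / (1 - τ) := by
        ring
      rw [heq, abs_div, abs_mul, abs_two, abs_of_pos hs, div_le_div_iff₀ hs hq]
      calc 2 * |α 1 τ - l₁| * √(1 - τ)
          ≤ 2 * (2 * ((2 + r) * √M) * √(1 - τ)) * √(1 - τ) := by gcongr; exact hrate τ hτ
        _ = 4 * ((2 + r) * √M) * (√(1 - τ) * √(1 - τ)) := by ring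
        _ = 4 * ((2 + r) * √M) * (1 - τ) := by rw [Real.mul_self_sqrt hs.le]
  obtain ⟨g₁, hg₁, hg₁_eq, hg₁_one, hg₁_deriv⟩ := exists_contDiffOn_Ioc_of_tendsto
    (f := fun τ => α 1 τ - -2 * l₁ * (1 - τ) * Real.log (1 - τ))
    (f' := fun τ => α 1 τ - (α 0 τ + 2 * l₁ * Real.log (1 - τ)) + r * α 2 τ - 2 * l₁)
    (l := l₁) (by norm_num : (-1 : ℝ) < 1)
    ((hreg 1).sub ((contDiffOn_const.mul (contDiffOn_const.sub contDiffOn_id)).mul hlog_reg))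
    (fun τ hτ => by
      have hs : 1 - τ ≠ 0 := (sub_pos.2 hτ.2).ne'
      refine ((h₁ τ hτ).sub ((((hasDerivAt_id τ).const_sub 1).const_mul (-2 * l₁)).mul
        (hlog τ hτ))).congr_deriv ?_
      simp only [id]
      field_simp
      ring)
    (by
      refine (hl₁.sub (hslog.const_mul (-2 * l₁))).congr (fun τ => ?_) |>.trans (by simp)
      ring)
    (((hl₁.sub hl₀).add (hl₂.const_mul r)).sub_const (2 * l₁))
  have hslope : Tendsto (slope g₁ 1) (𝓝[<] 1) (𝓝 (l₁ - l₀ + r * l₂ - 2 * l₁)) := by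
    have := hasDerivWithinAt_iff_tendsto_slope.1 hg₁_deriv
    rwa [Iic_sdiff_right] at this
  obtain ⟨g₀, hg₀, hg₀_eq, -⟩ := exists_contDiffOn_Ioc_of_tendsto
    (f := fun τ => α 0 τ - -2 * l₁ * (1 - 2 * (1 - τ)) * Real.log (1 - τ))
    (f' := fun τ => 2 * α 1 τ / (1 - τ) + 4 * l₁ * Real.log (1 - τ)
      - 2 * l₁ * (1 - 2 * (1 - τ)) / (1 - τ))
    (l := l₀) (by norm_num : (-1 : ℝ) < 1)
    ((hreg 0).sub ((contDiffOn_const.mul (contDiffOn_const.sub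
      (contDiffOn_const.mul (contDiffOn_const.sub contDiffOn_id)))).mul hlog_reg))
    (fun τ hτ => by
      refine ((h₀ τ hτ).sub ((((((hasDerivAt_id τ).const_sub 1).const_mul 2).const_sub
        1).const_mul (-2 * l₁)).mul (hlog τ hτ))).congr_deriv ?_
      simp only [id]
      ring)
    (by
      refine (hl₀.sub (hslog.const_mul (4 * l₁))).congr (fun τ => ?_) |>.trans (by simp)
      simp only [Pi.add_apply]
      ring)
    (by
      refine ((hslope.const_mul (-2)).add_const (4 * l₁)).congr' ?_
      filter_upwards [Ioo_mem_nhdsLT (by norm_num : (-1 : ℝ) < 1)] with τ hτ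
      have hs : 1 - τ ≠ 0 := (sub_pos.2 hτ.2).ne'
      have hs' : τ - 1 ≠ 0 := sub_ne_zero.2 hτ.2.ne
      rw [slope_def_field, hg₁_one, hg₁_eq hτ, ← neg_sub 1 τ, div_neg]
      field_simp
      ring)
  have hab : (-1 : ℝ) < 1 := by norm_num
  obtain ⟨g₂, hg₂, hg₂_eq, -⟩ := exists_contDiffOn_Ioc_of_tendsto hab (hreg 2) h₂ hl₂
    ((hl₁.const_mul (-r)).add (hl₃.const_mul r))
  obtain ⟨g₃, hg₃, hg₃_eq, -⟩ := exists_contDiffOn_Ioc_of_tendsto hab (hreg 3) h₃ hl₃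
    ((hl₃.neg.sub (hl₂.const_mul r)).add hl₄)
  have hp : Tendsto (fun τ : ℝ => 1 + τ) (𝓝[<] 1) (𝓝 (1 + 1)) :=
    ((continuous_const.add continuous_id).tendsto 1).mono_left nhdsWithin_le_nhds
  obtain ⟨g₄, hg₄, hg₄_eq, -⟩ := exists_contDiffOn_Ioc_of_tendsto hab (hreg 4) h₄ hl₄
    ((hl₃.const_mul (-2)).div hp (by norm_num))
  refine ⟨-2 * l₁, ⟨g₀, hg₀, hg₀_eq⟩, ⟨g₁, hg₁, hg₁_eq⟩, fun n hn => ?_⟩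
  fin_cases n
  · simp at hn
  · simp at hn
  · exact ⟨g₂, hg₂, hg₂_eq⟩
  · exact ⟨g₃, hg₃, hg₃_eq⟩
  · exact ⟨g₄, hg₄, hg₄_eq⟩
end

section
/- Let ℓ = 3, so λ₀ = 2√3 and λ₁ = √10. Let α₀,…,α₄ : (−1,1) → ℝ be C¹ functions satisfying the α-evolution system on (−1,1) and the α-constraints at τ = 0. Then there exists a constant K ∈ ℝ such that the function τ ↦ α₀(τ) − K(1−τ)ln(1−τ) extends to a C¹ function on (−1,1], and α₁, α₂, α₃, α₄ extend to C¹ functions on (−1,1]. -/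
open Set Filter Topology

/-- A function dominated in derivative by `h'` has increments dominated by those of `h`. -/
lemma abs_sub_le_of_abs_deriv_le {a b : ℝ} {f f' h h' : ℝ → ℝ}
    (hf : ∀ t ∈ Ico a b, HasDerivAt f (f' t) t) (hh : ∀ t ∈ Ico a b, HasDerivAt h (h' t) t)
    (hle : ∀ t ∈ Ico a b, |f' t| ≤ h' t) {x y : ℝ} (hx : x ∈ Ico a b) (hy : y ∈ Ico a b)
    (hxy : x ≤ y) : |f y - f x| ≤ h y - h x := by
  have h_add : MonotoneOn (fun t => h t + f t) (Ico a b) := by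
    refine monotoneOn_of_hasDerivWithinAt_nonneg (f' := fun t => h' t + f' t) (convex_Ico a b)
      (fun t ht => ((hh t ht).add (hf t ht)).continuousAt.continuousWithinAt)
      (fun t ht => ((hh t (interior_subset ht)).add
        (hf t (interior_subset ht))).hasDerivWithinAt) fun t ht => ?_
    have := abs_le.1 (hle t (interior_subset ht))
    linarith
  have h_sub : MonotoneOn (fun t => h t - f t) (Ico a b) := by
    refine monotoneOn_of_hasDerivWithinAt_nonneg (f' := fun t => h' t - f' t) (convex_Ico a b)
      (fun t ht => ((hh t ht).sub (hf t ht)).continuousAt.continuousWithinAt)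
      (fun t ht => ((hh t (interior_subset ht)).sub
        (hf t (interior_subset ht))).hasDerivWithinAt) fun t ht => ?_
    have := abs_le.1 (hle t (interior_subset ht))
    linarith
  have h1 := h_add hx hy hxy
  have h2 := h_sub hx hy hxy
  simp only at h1 h2
  rw [abs_le]
  constructor <;> linarith

/-- If `|f'| ≤ h'` on `[a, b)` with `h` bounded above, then `f` has a left limit at `b`. -/
lemma exists_tendsto_of_abs_deriv_le {a b B : ℝ} (hab : a < b) {f f' h h' : ℝ → ℝ}
    (hf : ∀ t ∈ Ico a b, HasDerivAt f (f' t) t) (hh : ∀ t ∈ Ico a b, HasDerivAt h (h' t) t)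
    (hle : ∀ t ∈ Ico a b, |f' t| ≤ h' t) (hB : ∀ t ∈ Ico a b, h t ≤ B) :
    ∃ l, Tendsto f (𝓝[<] b) (𝓝 l) := by
  have key := fun {x y : ℝ} => abs_sub_le_of_abs_deriv_le hf hh hle (x := x) (y := y)
  have ha : a ∈ Ico a b := ⟨le_rfl, hab⟩
  have h1 : MonotoneOn h (Ioo a b) := fun x hx y hy hxy => by
    have := (abs_nonneg _).trans (key (Ioo_subset_Ico_self hx) (Ioo_subset_Ico_self hy) hxy)
    linarith
  have h2 : MonotoneOn (fun t => h t + f t) (Ioo a b) := fun x hx y hy hxy => by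
    have := (abs_le.1 (key (Ioo_subset_Ico_self hx) (Ioo_subset_Ico_self hy) hxy)).1
    simp only
    linarith
  have l1 := h1.tendsto_nhdsWithin_Ioo_left (nonempty_Ioo.2 hab) ⟨B, by
    rintro _ ⟨t, ht, rfl⟩
    exact hB t (Ioo_subset_Ico_self ht)⟩
  have l2 := h2.tendsto_nhdsWithin_Ioo_left (nonempty_Ioo.2 hab) ⟨f a + 2 * B - h a, by
    rintro _ ⟨t, ht, rfl⟩
    have := (abs_le.1 (key ha (Ioo_subset_Ico_self ht) ht.1.le)).2
    have := hB t (Ioo_subset_Ico_self ht)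
    simp only
    linarith⟩
  exact ⟨_, (l2.sub l1).congr fun t => by ring⟩

/-- A `C¹` function on `(a, b)` such that it and its derivative have left limits at `b` extends
to a `C¹` function on `(a, b]`. -/
lemma exists_contDiffOn_Ioc_extension {a b l L : ℝ} (hab : a < b) {f : ℝ → ℝ}
    (hf : ContDiffOn ℝ 1 f (Ioo a b)) (hl : Tendsto f (𝓝[<] b) (𝓝 l))
    (hL : Tendsto (deriv f) (𝓝[<] b) (𝓝 L)) :
    ∃ g : ℝ → ℝ, ContDiffOn ℝ 1 g (Ioc a b) ∧ ∀ t ∈ Ioo a b, g t = f t := by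
  classical
  have hg : ∀ t ∈ Ioo a b, Function.update f b l t = f t := fun t ht =>
    Function.update_of_ne ht.2.ne _ _
  refine ⟨Function.update f b l, ?_, hg⟩
  have hmem : Ioo a b ∈ 𝓝[<] b := Ioo_mem_nhdsLT hab
  have hev : ∀ t ∈ Ioo a b, Function.update f b l =ᶠ[𝓝 t] f := fun t ht =>
    eventually_of_mem (isOpen_Ioo.mem_nhds ht) hg
  have hdiff : ∀ t ∈ Ioo a b, HasDerivAt (Function.update f b l) (deriv f t) t := fun t ht =>
    (((hf.differentiableOn one_ne_zero).differentiableAt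
      (isOpen_Ioo.mem_nhds ht)).hasDerivAt).congr_of_eventuallyEq (hev t ht)
  have hb : HasDerivWithinAt (Function.update f b l) L (Ioc a b) b := by
    refine (hasDerivWithinAt_Iic_of_tendsto_deriv (s := Ioo a b)
      (fun t ht => (hdiff t ht).differentiableAt.differentiableWithinAt) ?_ hmem ?_).mono
      Ioc_subset_Iic_self
    · rw [continuousWithinAt_update_same]
      exact hl.mono_left (nhdsWithin_mono _ fun t ht => ht.1.2)
    · exact hL.congr' (eventually_of_mem hmem fun t ht => (hdiff t ht).deriv.symm)
  have hd : EqOn (derivWithin (Function.update f b l) (Ioc a b))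
      (Function.update (deriv f) b L) (Ioc a b) := fun t ht => by
    have hu := uniqueDiffOn_Ioc a b t ht
    rcases ht.2.eq_or_lt with rfl | htb
    · rw [Function.update_self, hb.derivWithin hu]
    · rw [Function.update_of_ne htb.ne, (hdiff t ⟨ht.1, htb⟩).hasDerivWithinAt.derivWithin hu]
  rw [contDiffOn_one_iff_derivWithin (uniqueDiffOn_Ioc a b)]
  constructor
  · intro t ht
    rcases ht.2.eq_or_lt with rfl | htb
    · exact hb.differentiableWithinAt
    · exact (hdiff t ⟨ht.1, htb⟩).differentiableAt.differentiableWithinAt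
  · refine ContinuousOn.congr (fun t ht => ?_) hd
    rcases ht.2.eq_or_lt with rfl | htb
    · rw [continuousWithinAt_update_same]
      exact hL.mono_left (nhdsWithin_mono _ fun s hs => lt_of_le_of_ne hs.1.2 hs.2)
    · have hc := (hf.continuousOn_deriv_of_isOpen isOpen_Ioo le_rfl).continuousAt
        (isOpen_Ioo.mem_nhds ⟨ht.1, htb⟩)
      exact (hc.congr (eventually_of_mem (isOpen_Ioo.mem_nhds ⟨ht.1, htb⟩) fun s hs =>
        (Function.update_of_ne hs.2.ne _ _).symm)).continuousWithinAt

/-- Grönwall's inequality for a nonnegative quantity: `E' ≤ C E` on `[0, 1)` bounds `E`. -/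
lemma exists_bound_of_deriv_le_mul {E E' : ℝ → ℝ} {C : ℝ} (hC : 0 ≤ C) (h0 : 0 ≤ E 0)
    (hE : ∀ t ∈ Ico (0 : ℝ) 1, HasDerivAt E (E' t) t) (hle : ∀ t ∈ Ico (0 : ℝ) 1, E' t ≤ C * E t) :
    ∃ M, ∀ t ∈ Ico (0 : ℝ) 1, E t ≤ M := by
  have hder : ∀ t ∈ Ico (0 : ℝ) 1, HasDerivAt (fun t => Real.exp (-C * t) * E t)
      (Real.exp (-C * t) * (E' t - C * E t)) t := fun t ht => by
    have := ((hasDerivAt_id t).const_mul (-C)).exp.mul (hE t ht)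
    refine this.congr_deriv ?_
    simp only [id]
    ring
  have hanti : AntitoneOn (fun t => Real.exp (-C * t) * E t) (Ico 0 1) :=
    antitoneOn_of_hasDerivWithinAt_nonpos (convex_Ico 0 1)
      (fun t ht => (hder t ht).continuousAt.continuousWithinAt)
      (fun t ht => (hder t (interior_subset ht)).hasDerivWithinAt) fun t ht =>
        mul_nonpos_of_nonneg_of_nonpos (Real.exp_pos _).le
          (sub_nonpos.2 (hle t (interior_subset ht)))
  refine ⟨Real.exp C * E 0, fun t ht => ?_⟩
  have h1 : Real.exp (-C * t) * E t ≤ E 0 := by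
    simpa using hanti ⟨le_rfl, one_pos⟩ ht ht.1
  have h2 : E t = Real.exp (C * t) * (Real.exp (-C * t) * E t) := by
    rw [← mul_assoc, ← Real.exp_add]
    simp
  rw [h2]
  calc Real.exp (C * t) * (Real.exp (-C * t) * E t) ≤ Real.exp (C * t) * E 0 :=
        mul_le_mul_of_nonneg_left h1 (Real.exp_pos _).le
    _ ≤ Real.exp C * E 0 :=
        mul_le_mul_of_nonneg_right (Real.exp_le_exp.2 (by nlinarith [ht.2])) h0

/-- Solutions of the regularised system, with `w = a - q b`, stay bounded up to the singular
endpoint. -/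
lemma exists_bound_of_alpha_system {p q : ℝ} (hp : |p| ≤ 4) (hq : |q| ≤ 4)
    {w b c d e : ℝ → ℝ}
    (hw : ∀ t ∈ Ico (0 : ℝ) 1, HasDerivAt w
      (-w t / (1 - t) - q * (b t - q / 2 * (w t + q * b t) + p / 2 * c t)) t)
    (hb : ∀ t ∈ Ico (0 : ℝ) 1, HasDerivAt b (b t - q / 2 * (w t + q * b t) + p / 2 * c t) t)
    (hc : ∀ t ∈ Ico (0 : ℝ) 1, HasDerivAt c (-(p / 2) * b t + p / 2 * d t) t)
    (hd : ∀ t ∈ Ico (0 : ℝ) 1, HasDerivAt d (-d t - p / 2 * c t + q / 2 * e t) t)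
    (he : ∀ t ∈ Ico (0 : ℝ) 1, HasDerivAt e ((-q * d t + e t) / (1 + t)) t) :
    ∃ M, ∀ t ∈ Ico (0 : ℝ) 1, |w t| ≤ M ∧ |b t| ≤ M ∧ |c t| ≤ M ∧ |d t| ≤ M ∧ |e t| ≤ M := by
  obtain ⟨M, hM⟩ := exists_bound_of_deriv_le_mul (C := 400) (by norm_num)
    (E := fun t => w t ^ 2 + b t ^ 2 + c t ^ 2 + d t ^ 2 + e t ^ 2) (by positivity)
    (fun t ht => (((((hw t ht).pow 2).add ((hb t ht).pow 2)).add ((hc t ht).pow 2)).add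
      ((hd t ht).pow 2)).add ((he t ht).pow 2)) (fun t ht => by
      generalize w t = w, b t = b, c t = c, d t = d, e t = e
      have h1 : 0 < 1 - t := sub_pos.2 ht.2
      have h2 : 1 ≤ 1 + t := by linarith [ht.1]
      set E := w ^ 2 + b ^ 2 + c ^ 2 + d ^ 2 + e ^ 2 with hE
      have key : ∀ k K x y : ℝ, |k| ≤ K → x ^ 2 ≤ E → y ^ 2 ≤ E → k * (x * y) ≤ K * E := by
        intro k K x y hk hx hy
        have hxy : |x * y| ≤ E := abs_le.2
          ⟨by nlinarith [sq_nonneg (x + y)], by nlinarith [sq_nonneg (x - y)]⟩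
        calc k * (x * y) ≤ |k * (x * y)| := le_abs_self _
          _ = |k| * |x * y| := abs_mul _ _
          _ ≤ K * E := mul_le_mul hk hxy (abs_nonneg _) ((abs_nonneg _).trans hk)
      have hwE : w ^ 2 ≤ E := by rw [hE]; nlinarith
      have hbE : b ^ 2 ≤ E := by rw [hE]; nlinarith
      have hcE : c ^ 2 ≤ E := by rw [hE]; nlinarith
      have hdE : d ^ 2 ≤ E := by rw [hE]; nlinarith
      have heE : e ^ 2 ≤ E := by rw [hE]; nlinarith
      have hww : 0 ≤ w ^ 2 / (1 - t) := by positivity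
      have hp' := abs_le.1 hp
      have hq' := abs_le.1 hq
      have hqq : q ^ 2 ≤ 16 := by nlinarith
      have hinv : |(1 + t)⁻¹| ≤ 1 := by
        rw [abs_of_pos (by positivity)]
        exact inv_le_one_of_one_le₀ h2
      have hpq : |p * q| ≤ 16 := by
        rw [abs_mul]
        nlinarith [abs_nonneg p, abs_nonneg q]
      have k1 := key (q ^ 3 - 2 * q) 72 w b (by
        rw [show q ^ 3 - 2 * q = q * (q ^ 2 - 2) by ring, abs_mul]
        have : |q ^ 2 - 2| ≤ 18 := abs_le.2 ⟨by nlinarith, by linarith⟩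
        nlinarith [abs_nonneg q, abs_nonneg (q ^ 2 - 2)]) hwE hbE
      have k2 := key (q ^ 2) 16 w w (by rwa [abs_of_nonneg (sq_nonneg q)]) hwE hwE
      have k3 := key (-(p * q)) 16 w c (by rwa [abs_neg]) hwE hcE
      have k4 := key (2 - q ^ 2) 18 b b (abs_le.2 ⟨by linarith, by nlinarith⟩) hbE hbE
      have k5 := key (-q) 4 b w (by rwa [abs_neg]) hbE hwE
      have k6 := key q 4 d e hq hdE heE
      have k7 := key (-2) 2 d d (by norm_num) hdE hdE
      have k8 := key (2 * (1 + t)⁻¹) 2 e e (by rw [abs_mul, abs_two]; linarith) heE heE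
      have k9 := key (-(2 * (1 + t)⁻¹ * q)) 8 e d (by
        rw [abs_neg, abs_mul, abs_mul, abs_two]
        nlinarith [abs_nonneg q, abs_nonneg (1 + t)⁻¹]) heE hdE
      have hE0 : 0 ≤ E := (sq_nonneg w).trans hwE
      have hid : ((2 : ℕ) : ℝ) * w ^ (2 - 1)
            * (-w / (1 - t) - q * (b - q / 2 * (w + q * b) + p / 2 * c))
          + (2 : ℕ) * b ^ (2 - 1) * (b - q / 2 * (w + q * b) + p / 2 * c)
          + (2 : ℕ) * c ^ (2 - 1) * (-(p / 2) * b + p / 2 * d)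
          + (2 : ℕ) * d ^ (2 - 1) * (-d - p / 2 * c + q / 2 * e)
          + (2 : ℕ) * e ^ (2 - 1) * ((-q * d + e) / (1 + t))
          = -2 * (w ^ 2 / (1 - t)) + (q ^ 3 - 2 * q) * (w * b) + q ^ 2 * (w * w)
            + -(p * q) * (w * c) + (2 - q ^ 2) * (b * b) + -q * (b * w) + q * (d * e)
            + -2 * (d * d) + 2 * (1 + t)⁻¹ * (e * e) + -(2 * (1 + t)⁻¹ * q) * (e * d) := by
        push_cast
        ring
      linarith)
  have hs : ∀ x : ℝ, x ^ 2 ≤ M → |x| ≤ M + 1 := fun x hx =>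
    abs_le.2 ⟨by nlinarith [sq_nonneg (x + 1)], by nlinarith [sq_nonneg (x - 1)]⟩
  refine ⟨M + 1, fun t ht => ?_⟩
  have := hM t ht
  have := sq_nonneg (w t)
  have := sq_nonneg (b t)
  have := sq_nonneg (c t)
  have := sq_nonneg (d t)
  have := sq_nonneg (e t)
  refine ⟨hs _ ?_, hs _ ?_, hs _ ?_, hs _ ?_, hs _ ?_⟩ <;> linarith

lemma hasDerivAt_log_one_sub {t : ℝ} (ht : t < 1) :
    HasDerivAt (fun s => Real.log (1 - s)) (-(1 - t)⁻¹) t := by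
  refine (((hasDerivAt_id t).const_sub 1).log (sub_pos.2 ht).ne').congr_deriv ?_
  simp [neg_div]

/-- Solutions of `w' = -w / (1 - t) - k f` with `f` bounded are `O((1 - t) (1 - log (1 - t)))`. -/
lemma exists_abs_le_mul_log {w f : ℝ → ℝ} {k C : ℝ}
    (hw : ∀ t ∈ Ico (0 : ℝ) 1, HasDerivAt w (-w t / (1 - t) - k * f t) t)
    (hf : ∀ t ∈ Ico (0 : ℝ) 1, |f t| ≤ C) :
    ∃ D, ∀ t ∈ Ico (0 : ℝ) 1, |w t| ≤ D * ((1 - t) * (1 - Real.log (1 - t))) := by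
  have hC : 0 ≤ C := (abs_nonneg _).trans (hf 0 ⟨le_rfl, one_pos⟩)
  refine ⟨|w 0| + |k| * C, fun t ht => ?_⟩
  have h1 : 0 < 1 - t := sub_pos.2 ht.2
  have key := abs_sub_le_of_abs_deriv_le (a := 0) (b := 1) (f := fun s => w s / (1 - s))
    (f' := fun s => -(k * f s) * (1 - s)⁻¹) (h := fun s => -(|k| * C) * Real.log (1 - s))
    (h' := fun s => |k| * C * (1 - s)⁻¹)
    (fun s hs => by
      have h : 1 - s ≠ 0 := (sub_pos.2 hs.2).ne'
      refine ((hw s hs).div ((hasDerivAt_id s).const_sub 1) h).congr_deriv ?_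
      simp only [id]
      field_simp
      ring)
    (fun s hs => ((hasDerivAt_log_one_sub hs.2).const_mul _).congr_deriv (by ring))
    (fun s hs => by
      have h : 0 < 1 - s := sub_pos.2 hs.2
      rw [abs_mul, abs_neg, abs_mul, abs_of_pos (inv_pos.2 h)]
      gcongr
      exact hf s hs)
    ⟨le_rfl, one_pos⟩ ht ht.1
  simp only [sub_zero, div_one, Real.log_one, mul_zero] at key
  have hlog : Real.log (1 - t) ≤ 0 := Real.log_nonpos h1.le (by linarith [ht.1])
  have h2 : |w t / (1 - t)| ≤ (|w 0| + |k| * C) * (1 - Real.log (1 - t)) := by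
    have := abs_sub_abs_le_abs_sub (w t / (1 - t)) (w 0)
    nlinarith [abs_nonneg (w 0), mul_nonneg (abs_nonneg k) hC]
  rw [abs_div, abs_of_pos h1, div_le_iff₀ h1] at h2
  linarith

/-- After removing the logarithm, `w / (1 - t)` has a limit at the singular endpoint. -/
lemma exists_tendsto_div_sub_log {w f : ℝ → ℝ} {k y D : ℝ}
    (hw : ∀ t ∈ Ico (0 : ℝ) 1, HasDerivAt w (-w t / (1 - t) - k * f t) t)
    (hf : ∀ t ∈ Ico (0 : ℝ) 1, |f t - y| ≤ D * ((1 - t) * (1 - Real.log (1 - t)))) :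
    ∃ V, Tendsto (fun t => w t / (1 - t) - k * y * Real.log (1 - t)) (𝓝[<] 1) (𝓝 V) := by
  have hD : 0 ≤ D := by simpa using (abs_nonneg _).trans (hf 0 ⟨le_rfl, one_pos⟩)
  refine exists_tendsto_of_abs_deriv_le (zero_lt_one' ℝ)
    (f' := fun s => -(k * (f s - y)) * (1 - s)⁻¹)
    (h := fun s => |k| * D * (2 * s + (1 - s) * Real.log (1 - s)))
    (h' := fun s => |k| * D * (1 - Real.log (1 - s))) (B := |k| * D * 2) ?_ ?_ ?_ ?_
  · intro s hs
    have h : 1 - s ≠ 0 := (sub_pos.2 hs.2).ne'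
    refine (((hw s hs).div ((hasDerivAt_id s).const_sub 1) h).sub
      ((hasDerivAt_log_one_sub hs.2).const_mul (k * y))).congr_deriv ?_
    simp only [id]
    field_simp
    ring
  · intro s hs
    have h : 1 - s ≠ 0 := (sub_pos.2 hs.2).ne'
    refine ((((hasDerivAt_id s).const_mul 2).add (((hasDerivAt_id s).const_sub 1).mul
      (hasDerivAt_log_one_sub hs.2))).const_mul _).congr_deriv ?_
    simp only [id]
    field_simp
    ring
  · intro s hs
    have h : 0 < 1 - s := sub_pos.2 hs.2
    rw [abs_mul, abs_neg, abs_mul, abs_of_pos (inv_pos.2 h), ← div_eq_mul_inv, div_le_iff₀ h]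
    have := mul_le_mul_of_nonneg_left (hf s hs) (abs_nonneg k)
    linarith
  · intro s hs
    have h : 0 < 1 - s := sub_pos.2 hs.2
    have : Real.log (1 - s) ≤ 0 := Real.log_nonpos h.le (by linarith [hs.1])
    refine mul_le_mul_of_nonneg_left ?_ (mul_nonneg (abs_nonneg k) hD)
    nlinarith [hs.2]

lemma tendsto_one_sub_mul_log :
    Tendsto (fun t : ℝ => (1 - t) * Real.log (1 - t)) (𝓝[<] 1) (𝓝 0) := by
  have h : Continuous fun t : ℝ => (1 - t) * Real.log (1 - t) :=
    Real.continuous_mul_log.comp (continuous_const.sub continuous_id)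
  simpa using (h.tendsto 1).mono_left (nhdsWithin_le_nhds (s := Iio 1))

/-- A function with bounded derivative on `[0, 1)` has a left limit at `1`, and converges to it
at a linear rate. -/
lemma exists_tendsto_and_abs_sub_le {f f' : ℝ → ℝ} {C : ℝ}
    (hf : ∀ t ∈ Ico (0 : ℝ) 1, HasDerivAt f (f' t) t) (hC : ∀ t ∈ Ico (0 : ℝ) 1, |f' t| ≤ C) :
    ∃ l, Tendsto f (𝓝[<] 1) (𝓝 l) ∧ ∀ t ∈ Ico (0 : ℝ) 1, |f t - l| ≤ C * (1 - t) := by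
  have hC0 : 0 ≤ C := (abs_nonneg _).trans (hC 0 ⟨le_rfl, one_pos⟩)
  have hh : ∀ t ∈ Ico (0 : ℝ) 1, HasDerivAt (fun s => C * s) C t := fun t _ =>
    ((hasDerivAt_id t).const_mul C).congr_deriv (mul_one C)
  obtain ⟨l, hl⟩ := exists_tendsto_of_abs_deriv_le (B := C) one_pos hf hh hC
    fun t ht => by nlinarith [ht.2]
  refine ⟨l, hl, fun t ht => ?_⟩
  rw [abs_sub_comm]
  refine le_of_tendsto ((hl.sub_const (f t)).abs)
    (eventually_of_mem (Ioo_mem_nhdsLT ht.2) fun s hs => ?_)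
  have := abs_sub_le_of_abs_deriv_le hf hh hC ht ⟨ht.1.trans hs.1.le, hs.2⟩ hs.1.le
  nlinarith [hs.2]

lemma abs_linear_combination_le {x y z u v s M : ℝ} (hu : |u| ≤ M) (hv : |v| ≤ M) (hs : |s| ≤ M) :
    |x * u + y * v + z * s| ≤ (|x| + |y| + |z|) * M := by
  have h := (abs_add_le (x * u + y * v) (z * s)).trans
    (add_le_add_left (abs_add_le (x * u) (y * v)) _)
  rw [abs_mul, abs_mul, abs_mul] at h
  nlinarith [mul_le_mul_of_nonneg_left hu (abs_nonneg x),
    mul_le_mul_of_nonneg_left hv (abs_nonneg y), mul_le_mul_of_nonneg_left hs (abs_nonneg z)]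

/-- The leading logarithm of solutions of the `ℓ = 3` evolution system; the constraints are not
needed. -/
lemma alpha_C1_extension_of_evol {p q : ℝ} (hp : |p| ≤ 4) (hq : |q| ≤ 4) {α : Fin 5 → ℝ → ℝ}
    (hreg : ∀ n, ContDiffOn ℝ 1 (α n) (Ioo (-1 : ℝ) 1)) (hev : AlphaEvol 3 p q α) :
    ∃ K : ℝ,
      (∃ g : ℝ → ℝ, ContDiffOn ℝ 1 g (Ioc (-1 : ℝ) 1) ∧
        ∀ τ ∈ Ioo (-1 : ℝ) 1, g τ = α 0 τ - K * (1 - τ) * Real.log (1 - τ)) ∧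
      (∀ n : Fin 5, 1 ≤ (n : ℕ) →
        ∃ g : ℝ → ℝ, ContDiffOn ℝ 1 g (Ioc (-1 : ℝ) 1) ∧
          ∀ τ ∈ Ioo (-1 : ℝ) 1, g τ = α n τ) := by
  have hlt : (-1 : ℝ) < 1 := by norm_num
  have hsub : ∀ t ∈ Ico (0 : ℝ) 1, t ∈ Ioo (-1 : ℝ) 1 := fun t ht => ⟨by linarith [ht.1], ht.2⟩
  have hder : ∀ n, ∀ t ∈ Ioo (-1 : ℝ) 1, HasDerivAt (α n) (deriv (α n) t) t := fun n t ht =>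
    (((hreg n).differentiableOn one_ne_zero).differentiableAt
      (isOpen_Ioo.mem_nhds ht)).hasDerivAt
  set w : ℝ → ℝ := fun t => α 0 t - q * α 1 t with hw_def
  set F : ℝ → ℝ := fun t => α 1 t - q / 2 * (w t + q * α 1 t) + p / 2 * α 2 t with hF_def
  have hα0 : ∀ t ∈ Ioo (-1 : ℝ) 1, deriv (α 0) t = -w t / (1 - t) := fun t ht => by
    rw [eq_div_iff (sub_pos.2 ht.2).ne', mul_comm, (hev t ht).1]
    simp only [hw_def]
    push_cast
    ring
  have hα1 : ∀ t ∈ Ioo (-1 : ℝ) 1, deriv (α 1) t = F t := fun t ht => by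
    rw [(hev t ht).2.1]
    simp only [hF_def, hw_def]
    ring
  have hα2 := fun t ht => (hev t ht).2.2.1
  have hα3 := fun t ht => (hev t ht).2.2.2.1
  have hα4 : ∀ t ∈ Ioo (-1 : ℝ) 1, deriv (α 4) t = (-q * α 3 t + α 4 t) / (1 + t) :=
    fun t ht => by
    rw [eq_div_iff (by linarith [ht.1]), mul_comm, (hev t ht).2.2.2.2]
    push_cast
    ring
  have hw : ∀ t ∈ Ico (0 : ℝ) 1, HasDerivAt w (-w t / (1 - t) - q * F t) t := fun t ht => by
    rw [← hα0 t (hsub t ht), ← hα1 t (hsub t ht)]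
    exact (hder 0 t (hsub t ht)).sub ((hder 1 t (hsub t ht)).const_mul q)
  have hd1 := fun t ht => hα1 t (hsub t ht) ▸ hder 1 t (hsub t ht)
  have hd2 := fun t ht => hα2 t (hsub t ht) ▸ hder 2 t (hsub t ht)
  have hd3 := fun t ht => hα3 t (hsub t ht) ▸ hder 3 t (hsub t ht)
  have hd4 := fun t ht => hα4 t (hsub t ht) ▸ hder 4 t (hsub t ht)
  obtain ⟨M, hM⟩ := exists_bound_of_alpha_system hp hq hw hd1 hd2 hd3 hd4
  have hFC : ∀ t ∈ Ico (0 : ℝ) 1, |F t| ≤ (|1 - q ^ 2 / 2| + |-(q / 2)| + |p / 2|) * M :=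
    fun t ht => by
    obtain ⟨h0, h1, h2, -, -⟩ := hM t ht
    rw [show F t = (1 - q ^ 2 / 2) * α 1 t + -(q / 2) * w t + p / 2 * α 2 t by
      simp only [hF_def]; ring]
    exact abs_linear_combination_le h1 h0 h2
  have hC2 : ∀ t ∈ Ico (0 : ℝ) 1, |-(p / 2) * α 1 t + p / 2 * α 3 t|
      ≤ (|-(p / 2)| + |p / 2| + |0|) * M := fun t ht => by
    obtain ⟨-, h1, -, h3, -⟩ := hM t ht
    simpa using abs_linear_combination_le (x := -(p / 2)) (y := p / 2) (z := 0) h1 h3 h3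
  have hC3 : ∀ t ∈ Ico (0 : ℝ) 1, |-α 3 t - p / 2 * α 2 t + q / 2 * α 4 t|
      ≤ (|-1| + |-(p / 2)| + |q / 2|) * M := fun t ht => by
    obtain ⟨-, -, h2, h3, h4⟩ := hM t ht
    rw [show -α 3 t - p / 2 * α 2 t + q / 2 * α 4 t
      = -1 * α 3 t + -(p / 2) * α 2 t + q / 2 * α 4 t by ring]
    exact abs_linear_combination_le h3 h2 h4
  have hC4 : ∀ t ∈ Ico (0 : ℝ) 1, |(-q * α 3 t + α 4 t) / (1 + t)| ≤ (|-q| + |1| + |0|) * M :=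
    fun t ht => by
    obtain ⟨-, -, -, h3, h4⟩ := hM t ht
    have h := abs_linear_combination_le (x := -q) (y := 1) (z := 0) h3 h4 h4
    rw [one_mul, zero_mul, add_zero] at h
    rw [abs_div, abs_of_pos (by linarith [ht.1] : 0 < 1 + t)]
    exact (div_le_self (abs_nonneg _) (by linarith [ht.1])).trans h
  obtain ⟨l1, hl1, -⟩ := exists_tendsto_and_abs_sub_le hd1 hFC
  obtain ⟨l2, hl2, -⟩ := exists_tendsto_and_abs_sub_le hd2 hC2
  obtain ⟨l3, hl3, -⟩ := exists_tendsto_and_abs_sub_le hd3 hC3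
  obtain ⟨l4, hl4, -⟩ := exists_tendsto_and_abs_sub_le hd4 hC4
  obtain ⟨D, hD⟩ := exists_abs_le_mul_log hw hFC
  have hone : Tendsto (fun t : ℝ => 1 - t) (𝓝[<] 1) (𝓝 0) := by
    have h : Continuous fun t : ℝ => 1 - t := continuous_const.sub continuous_id
    simpa using (h.tendsto 1).mono_left (nhdsWithin_le_nhds (s := Iio 1))
  have hIco : Ico (0 : ℝ) 1 ∈ 𝓝[<] (1 : ℝ) := Ico_mem_nhdsLT one_pos
  have hIoo : Ioo (-1 : ℝ) 1 ∈ 𝓝[<] (1 : ℝ) := Ioo_mem_nhdsLT hlt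
  have hw0 : Tendsto w (𝓝[<] 1) (𝓝 0) := by
    refine squeeze_zero_norm' (eventually_of_mem hIco hD) ?_
    have := (hone.sub tendsto_one_sub_mul_log).const_mul D
    rw [sub_zero, mul_zero] at this
    exact this.congr fun t => by ring
  -- the part of `F` that is Lipschitz up to the endpoint
  obtain ⟨y, hy, hyC⟩ := exists_tendsto_and_abs_sub_le
    (f := fun t => (1 - q ^ 2 / 2) * α 1 t + p / 2 * α 2 t)
    (f' := fun t => (1 - q ^ 2 / 2) * F t + p / 2 * (-(p / 2) * α 1 t + p / 2 * α 3 t))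
    (fun t ht => ((hd1 t ht).const_mul _).add ((hd2 t ht).const_mul _))
    (fun t ht => by
      have h := add_le_add (mul_le_mul_of_nonneg_left (hFC t ht) (abs_nonneg (1 - q ^ 2 / 2)))
        (mul_le_mul_of_nonneg_left (hC2 t ht) (abs_nonneg (p / 2)))
      rw [← abs_mul, ← abs_mul] at h
      exact (abs_add_le _ _).trans h)
  have hFdecomp : ∀ t, F t = (1 - q ^ 2 / 2) * α 1 t + p / 2 * α 2 t - q / 2 * w t := fun t => by
    simp only [hF_def]
    ring
  have hFy : Tendsto F (𝓝[<] 1) (𝓝 y) := by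
    have := hy.sub (hw0.const_mul (q / 2))
    rw [mul_zero, sub_zero] at this
    exact this.congr fun t => (hFdecomp t).symm
  obtain ⟨B, hB⟩ : ∃ B, ∀ t ∈ Ico (0 : ℝ) 1,
      |(1 - q ^ 2 / 2) * α 1 t + p / 2 * α 2 t - y| ≤ B * (1 - t) := ⟨_, hyC⟩
  obtain ⟨V, hV⟩ : ∃ V, Tendsto (fun t => w t / (1 - t) - q * y * Real.log (1 - t))
      (𝓝[<] 1) (𝓝 V) := by
    refine exists_tendsto_div_sub_log hw (D := B + |q / 2| * D) fun t ht => ?_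
    have h1 : 0 < 1 - t := sub_pos.2 ht.2
    have hlog : Real.log (1 - t) ≤ 0 := Real.log_nonpos h1.le (by linarith [ht.1])
    have h2 := hB t ht
    have h3 := mul_le_mul_of_nonneg_left (hD t ht) (abs_nonneg (q / 2))
    rw [← abs_mul] at h3
    have h4 := h2.trans (mul_le_mul_of_nonneg_left
      (show 1 - t ≤ (1 - t) * (1 - Real.log (1 - t)) by nlinarith)
      (nonneg_of_mul_nonneg_left ((abs_nonneg _).trans h2) h1))
    rw [hFdecomp, sub_right_comm, add_mul, mul_assoc |q / 2|]
    exact (abs_sub _ _).trans (add_le_add h4 h3)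
  refine ⟨q * y, ?_, ?_⟩
  · refine exists_contDiffOn_Ioc_extension hlt (l := q * l1) (L := -V + q * y) ?_ ?_ ?_
    · refine (hreg 0).sub ((contDiffOn_const.mul (contDiffOn_const.sub contDiffOn_id)).mul
        ((contDiffOn_const.sub contDiffOn_id).log fun t ht => (sub_pos.2 ht.2).ne'))
    · have := (hw0.add (hl1.const_mul q)).sub (tendsto_one_sub_mul_log.const_mul (q * y))
      rw [zero_add, mul_zero, sub_zero] at this
      exact this.congr fun t => by simp only [hw_def]; ring
    · refine (hV.neg.add_const (q * y)).congr' (eventually_of_mem hIoo fun t ht => ?_)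
      have h1 : 1 - t ≠ 0 := (sub_pos.2 ht.2).ne'
      have h := (hder 0 t ht).sub ((((hasDerivAt_id t).const_sub 1).const_mul (q * y)).mul
        (hasDerivAt_log_one_sub ht.2))
      rw [hα0 t ht] at h
      refine (h.deriv.trans ?_).symm
      simp only [id]
      field_simp
      ring
  · intro n hn
    fin_cases n
    · exact absurd hn (by simp)
    · exact exists_contDiffOn_Ioc_extension hlt (hreg 1) hl1
        (hFy.congr' (eventually_of_mem hIoo fun t ht => (hα1 t ht).symm))
    · exact exists_contDiffOn_Ioc_extension hlt (hreg 2) hl2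
        (((hl1.const_mul _).add (hl3.const_mul _)).congr'
          (eventually_of_mem hIoo fun t ht => (hα2 t ht).symm))
    · exact exists_contDiffOn_Ioc_extension hlt (hreg 3) hl3
        (((hl3.neg.sub (hl2.const_mul _)).add (hl4.const_mul _)).congr'
          (eventually_of_mem hIoo fun t ht => (hα3 t ht).symm))
    · have h2 : Tendsto (fun t : ℝ => 1 + t) (𝓝[<] 1) (𝓝 (1 + 1)) :=
        ((continuous_const.add continuous_id).tendsto 1).mono_left nhdsWithin_le_nhds
      exact exists_contDiffOn_Ioc_extension hlt (hreg 4) hl4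
        ((((hl3.const_mul (-q)).add hl4).div h2 (by norm_num)).congr'
          (eventually_of_mem hIoo fun t ht => (hα4 t ht).symm))

/-- `ℓ = 3`, `λ₀ = 2√3`, `λ₁ = √10`: there is a constant `K` such that
`α₀ − K(1−τ)ln(1−τ)` extends to a C¹ function on `(−1,1]`, and `α₁, α₂, α₃, α₄`
extend to C¹ functions on `(−1,1]`. -/
theorem alpha_C1_extension_l3 (lam0 lam1 : ℝ)
    (hlam0 : lam0 = 2 * Real.sqrt 3) (hlam1 : lam1 = Real.sqrt 10)
    (α : Fin 5 → ℝ → ℝ)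
    (hreg : ∀ n, ContDiffOn ℝ 1 (α n) (Set.Ioo (-1 : ℝ) 1))
    (hev : AlphaEvol 3 lam0 lam1 α)
    (hcon : AlphaConstr0 3 lam0 lam1 α) :
    ∃ K : ℝ,
      (∃ g : ℝ → ℝ, ContDiffOn ℝ 1 g (Set.Ioc (-1 : ℝ) 1) ∧
        ∀ τ ∈ Set.Ioo (-1 : ℝ) 1,
          g τ = α 0 τ - K * (1 - τ) * Real.log (1 - τ)) ∧
      (∀ n : Fin 5, 1 ≤ (n : ℕ) →
        ∃ g : ℝ → ℝ, ContDiffOn ℝ 1 g (Set.Ioc (-1 : ℝ) 1) ∧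
          ∀ τ ∈ Set.Ioo (-1 : ℝ) 1, g τ = α n τ) := by
  have hq : |lam1| ≤ 4 := by
    rw [hlam1, abs_of_nonneg (Real.sqrt_nonneg _)]
    exact Real.sqrt_le_iff.2 ⟨by norm_num, by norm_num⟩
  have hp : |lam0| ≤ 4 := by
    rw [hlam0, abs_of_nonneg (by positivity)]
    have : Real.sqrt 3 ≤ 2 := Real.sqrt_le_iff.2 ⟨by norm_num, by norm_num⟩
    linarith
  exact alpha_C1_extension_of_evol hp hq hreg hev
end

section
/- Fix an integer ℓ ≥ 2 and set λ₀ = √(ℓ(ℓ+1)), λ₁ = √((ℓ−1)(ℓ+2)). Let α₀,…,α₄ : (−1,1) → ℝ be C¹ functions satisfying the α-evolution system on all of (−1,1), and suppose the α-constraints hold at τ = 0, i.e. −ℓα₁(0) + (1/2)(λ₁α₀(0) + λ₀α₂(0)) = 0, −ℓα₂(0) + (λ₀/2)(α₁(0) + α₃(0)) = 0, and −ℓα₃(0) + (1/2)(λ₁α₄(0) + λ₀α₂(0)) = 0. Then the α-constraints hold for every τ ∈ (−1,1): τα₁′(τ) − ℓα₁(τ) + (1/2)(λ₁α₀(τ)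 + λ₀α₂(τ)) = 0, τα₂′(τ) − ℓα₂(τ) + (λ₀/2)(α₁(τ) + α₃(τ)) = 0, and τα₃′(τ) − ℓα₃(τ) + (1/2)(λ₁α₄(τ) + λ₀α₂(τ)) = 0. That is, the constraints are propagated by the free evolution. -/
/-- If `E` is nonnegative, vanishes at `0`, and `|E'| ≤ K * E` on `(-1,1)`, then `E` vanishes
on `(-1,1)`. -/
lemma eq_zero_of_abs_deriv_le_mul {E E' : ℝ → ℝ} {K : ℝ}
    (hE : ∀ t ∈ Set.Ioo (-1 : ℝ) 1, HasDerivAt E (E' t) t)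
    (hbound : ∀ t ∈ Set.Ioo (-1 : ℝ) 1, |E' t| ≤ K * E t)
    (hnonneg : ∀ t ∈ Set.Ioo (-1 : ℝ) 1, 0 ≤ E t) (h0 : E 0 = 0) :
    ∀ t ∈ Set.Ioo (-1 : ℝ) 1, E t = 0 := by
  have hderiv : ∀ c, ∀ t ∈ Set.Ioo (-1 : ℝ) 1,
      HasDerivAt (fun s => E s * Real.exp (c * s)) ((E' t + c * E t) * Real.exp (c * t)) t := by
    intro c t ht
    have h := (hE t ht).mul ((hasDerivAt_id t).const_mul c).exp
    refine h.congr_deriv ?_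
    simp only [id]
    ring
  have hcont : ∀ c, ContinuousOn (fun s => E s * Real.exp (c * s)) (Set.Ioo (-1 : ℝ) 1) :=
    fun c t ht => (hderiv c t ht).continuousAt.continuousWithinAt
  have hmono : MonotoneOn (fun s => E s * Real.exp (K * s)) (Set.Ioo (-1 : ℝ) 1) := by
    refine monotoneOn_of_deriv_nonneg (convex_Ioo _ _) (hcont K) ?_ ?_ <;>
      rw [interior_Ioo] <;> intro t ht
    · exact (hderiv K t ht).differentiableAt.differentiableWithinAt
    · rw [(hderiv K t ht).deriv]
      have := (abs_le.1 (hbound t ht)).1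
      exact mul_nonneg (by linarith) (Real.exp_pos _).le
  have hanti : AntitoneOn (fun s => E s * Real.exp (-K * s)) (Set.Ioo (-1 : ℝ) 1) := by
    refine antitoneOn_of_deriv_nonpos (convex_Ioo _ _) (hcont (-K)) ?_ ?_ <;>
      rw [interior_Ioo] <;> intro t ht
    · exact (hderiv (-K) t ht).differentiableAt.differentiableWithinAt
    · rw [(hderiv (-K) t ht).deriv]
      have := (abs_le.1 (hbound t ht)).2
      exact mul_nonpos_of_nonpos_of_nonneg (by linarith) (Real.exp_pos _).le
  have hzero : (0 : ℝ) ∈ Set.Ioo (-1 : ℝ) 1 := by norm_num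
  intro t ht
  refine le_antisymm ?_ (hnonneg t ht)
  rcases le_total 0 t with h | h
  · have := hanti hzero ht h
    simp only [h0, zero_mul] at this
    exact nonpos_of_mul_nonpos_left this (Real.exp_pos _)
  · have := hmono ht hzero h
    simp only [h0, zero_mul] at this
    exact nonpos_of_mul_nonpos_left this (Real.exp_pos _)

/-- Uniqueness of the zero solution for the linear system satisfied by the constraint
quantities. -/
lemma constraint_system_eq_zero {x y z : ℝ → ℝ} {k : ℝ}
    (hx : ∀ t ∈ Set.Ioo (-1 : ℝ) 1, HasDerivAt x (x t + k * y t) t)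
    (hy : ∀ t ∈ Set.Ioo (-1 : ℝ) 1, HasDerivAt y (k * (z t - x t)) t)
    (hz : ∀ t ∈ Set.Ioo (-1 : ℝ) 1, HasDerivAt z (-z t - k * y t) t)
    (hx0 : x 0 = 0) (hy0 : y 0 = 0) (hz0 : z 0 = 0) :
    ∀ t ∈ Set.Ioo (-1 : ℝ) 1, x t = 0 ∧ y t = 0 ∧ z t = 0 := by
  have henergy : ∀ t ∈ Set.Ioo (-1 : ℝ) 1, x t ^ 2 + y t ^ 2 + z t ^ 2 = 0 := by
    refine eq_zero_of_abs_deriv_le_mul (E := fun t => x t ^ 2 + y t ^ 2 + z t ^ 2)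
      (E' := fun t => 2 * (x t ^ 2 - z t ^ 2)) (K := 2) ?_ ?_ ?_ ?_
    · intro t ht
      have h := (((hx t ht).pow 2).add ((hy t ht).pow 2)).add ((hz t ht).pow 2)
      refine h.congr_deriv ?_
      simp only [Nat.cast_ofNat]
      ring
    · intro t _
      rw [abs_le]
      constructor <;> nlinarith [sq_nonneg (x t), sq_nonneg (y t), sq_nonneg (z t)]
    · intro t _
      positivity
    · simp [hx0, hy0, hz0]
  intro t ht
  have h := henergy t ht
  refine ⟨?_, ?_, ?_⟩ <;> rw [← sq_eq_zero_iff] <;>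
    nlinarith [sq_nonneg (x t), sq_nonneg (y t), sq_nonneg (z t)]

/-- constraint propagation. If a C¹ solution of the α-evolution system on
`(−1,1)` satisfies the α-constraints at `τ = 0`, then the constraints hold for every
`τ ∈ (−1,1)`. -/
theorem alpha_constraint_propagation (ℓ : ℕ) (hℓ : 2 ≤ ℓ) (lam0 lam1 : ℝ)
    (hlam0 : lam0 = Real.sqrt ((ℓ : ℝ) * ((ℓ : ℝ) + 1)))
    (hlam1 : lam1 = Real.sqrt (((ℓ : ℝ) - 1) * ((ℓ : ℝ) + 2)))
    (α : Fin 5 → ℝ → ℝ)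
    (hreg : ∀ n, ContDiffOn ℝ 1 (α n) (Set.Ioo (-1 : ℝ) 1))
    (hev : AlphaEvol ℓ lam0 lam1 α)
    (hcon : AlphaConstr0 ℓ lam0 lam1 α) :
    ∀ τ ∈ Set.Ioo (-1 : ℝ) 1,
      (τ * deriv (α 1) τ - (ℓ : ℝ) * α 1 τ + 1 / 2 * (lam1 * α 0 τ + lam0 * α 2 τ) = 0) ∧
      (τ * deriv (α 2) τ - (ℓ : ℝ) * α 2 τ + lam0 / 2 * (α 1 τ + α 3 τ) = 0) ∧
      (τ * deriv (α 3) τ - (ℓ : ℝ) * α 3 τ + 1 / 2 * (lam1 * α 4 τ + lam0 * α 2 τ) = 0) := by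
  have hℓ' : (2 : ℝ) ≤ ℓ := by exact_mod_cast hℓ
  have h0sq : lam0 ^ 2 = (ℓ : ℝ) * (ℓ + 1) := by
    rw [hlam0, Real.sq_sqrt (by positivity)]
  have h1sq : lam1 ^ 2 = lam0 ^ 2 - 2 := by
    rw [h0sq, hlam1, Real.sq_sqrt (mul_nonneg (by linarith) (by linarith))]
    ring
  have hd : ∀ n, ∀ t ∈ Set.Ioo (-1 : ℝ) 1, HasDerivAt (α n) (deriv (α n) t) t := fun n t ht =>
    (((hreg n).differentiableOn one_ne_zero).differentiableAt
      (isOpen_Ioo.mem_nhds ht)).hasDerivAt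
  have hsub : ∀ t : ℝ, HasDerivAt (fun s : ℝ => 1 - s) (-1) t :=
    fun t => (hasDerivAt_id t).const_sub 1
  have hadd : ∀ t : ℝ, HasDerivAt (fun s : ℝ => 1 + s) 1 t :=
    fun t => (hasDerivAt_id t).const_add 1
  obtain ⟨hc1, hc2, hc3⟩ := hcon
  have key := constraint_system_eq_zero (k := lam0 / 2)
    (x := fun t => (t - ℓ) * α 1 t + lam1 / 2 * ((1 - t) * α 0 t)
      + lam0 / 2 * ((1 + t) * α 2 t))
    (y := fun t => lam0 / 2 * ((1 - t) * α 1 t + (1 + t) * α 3 t) - ℓ * α 2 t)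
    (z := fun t => -(t + ℓ) * α 3 t + lam0 / 2 * ((1 - t) * α 2 t)
      + lam1 / 2 * ((1 + t) * α 4 t))
    ?_ ?_ ?_ (by linear_combination hc1) (by linear_combination hc2) (by linear_combination hc3)
  · intro τ hτ
    obtain ⟨hx, hy, hz⟩ := key τ hτ
    obtain ⟨-, h1, h2, h3, -⟩ := hev τ hτ
    rw [h1, h2, h3]
    exact ⟨by linear_combination hx, by linear_combination hy, by linear_combination hz⟩
  · intro t ht
    obtain ⟨h0, h1, h2, -, -⟩ := hev t ht
    have h := ((((hasDerivAt_id t).sub_const (ℓ : ℝ)).mul (hd 1 t ht)).add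
      (((hsub t).mul (hd 0 t ht)).const_mul (lam1 / 2))).add
      (((hadd t).mul (hd 2 t ht)).const_mul (lam0 / 2))
    refine h.congr_deriv ?_
    simp only [id]
    rw [h1, h2]
    linear_combination (lam1 / 2) * h0 + (α 1 t / 2) * h1sq
  · intro t ht
    obtain ⟨-, h1, h2, h3, -⟩ := hev t ht
    have h := ((((hsub t).mul (hd 1 t ht)).add ((hadd t).mul (hd 3 t ht))).const_mul
      (lam0 / 2)).sub ((hd 2 t ht).const_mul (ℓ : ℝ))
    refine h.congr_deriv ?_
    rw [h1, h2, h3]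
    ring
  · intro t ht
    obtain ⟨-, -, h2, h3, h4⟩ := hev t ht
    have h := ((((hasDerivAt_id t).add_const (ℓ : ℝ)).neg.mul (hd 3 t ht)).add
      (((hsub t).mul (hd 2 t ht)).const_mul (lam0 / 2))).add
      (((hadd t).mul (hd 4 t ht)).const_mul (lam1 / 2))
    refine h.congr_deriv ?_
    simp only [id, Pi.neg_apply]
    rw [h2, h3]
    linear_combination (lam1 / 2) * h4 - (α 3 t / 2) * h1sq
end
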